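/- arXiv:2101.11304 — 2 statements merged into one kernel-verified Lean document; each statement's English description precedes it below -/
import Mathlib

section
/- Let n ≥ 5 be an integer and let v : ℝ → (0,∞) be a C⁴ solution of the Delaunay ODE v''''(t) − ((n(n−4)+8)/2) v''(t) + (n²(n−4)²/16) v(t) = (n(n−4)(n²−4)/16) v(t)^{(n+4)/(n−4)} defined on all of ℝ. Then either there exists T ∈ ℝ such that v(t) = (cosh(t−T))^{(4−n)/2} for all t, or v is periodic, i.e. there exists T > 0 with v(t+T) = v(t) for all t ∈ ℝ. -/
/-- The Delaunay ODE
`v'''' − ((n(n−4)+8)/2) v'' + (n²(n−4)²/16) v = (n(n−4)(n²−4)/16) v^{(n+4)/(n−4)}` at `t`. -/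
def DelaunayODE (n : ℕ) (v : ℝ → ℝ) (t : ℝ) : Prop :=
  iteratedDeriv 4 v t - (((n : ℝ) * ((n : ℝ) - 4) + 8)/2) * iteratedDeriv 2 v t
      + ((n : ℝ)^2 * ((n : ℝ) - 4)^2/16) * v t
    = ((n : ℝ) * ((n : ℝ) - 4) * ((n : ℝ)^2 - 4)/16) * v t ^ (((n : ℝ) + 4)/((n : ℝ) - 4))

open Set Filter Topology

/-- A positive function with derivatives `v1, v2, v3` solving the Delaunay ODE with `n = 2 * a + 4`,
whose linear part factors as `(D² - a²)(D² - (a+2)²)`. -/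
structure DelaunaySol (a : ℝ) (v v1 v2 v3 : ℝ → ℝ) : Prop where
  pos : ∀ t, 0 < v t
  d0 : ∀ t, HasDerivAt v (v1 t) t
  d1 : ∀ t, HasDerivAt v1 (v2 t) t
  d2 : ∀ t, HasDerivAt v2 (v3 t) t
  d3 : ∀ t, HasDerivAt v3 ((a ^ 2 + (a + 2) ^ 2) * v2 t - a ^ 2 * (a + 2) ^ 2 * v t
    + a * (a + 1) * (a + 2) * (a + 3) * v t ^ (1 + 4 / a)) t

/-- A function with `f' ≥ γ f` grows at least like `exp (γ t)`. -/
lemma mul_exp_le_of_deriv_ge {f f' : ℝ → ℝ} {γ s t : ℝ} (hst : s ≤ t)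
    (hf : ∀ x, HasDerivAt f (f' x) x) (h : ∀ x ∈ Ioo s t, γ * f x ≤ f' x) :
    f s * Real.exp (γ * (t - s)) ≤ f t := by
  have hd : ∀ x, HasDerivAt (fun x => f x * Real.exp (-γ * x))
      (f' x * Real.exp (-γ * x) + f x * (Real.exp (-γ * x) * (-γ * 1))) x := fun x =>
    (hf x).mul (((hasDerivAt_id x).const_mul (-γ)).exp)
  have hm : MonotoneOn (fun x => f x * Real.exp (-γ * x)) (Icc s t) := by
    apply monotoneOn_of_deriv_nonneg (convex_Icc s t)
      (fun x _ => (hd x).continuousAt.continuousWithinAt)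
      (fun x _ => (hd x).differentiableAt.differentiableWithinAt)
    intro x hx
    rw [interior_Icc] at hx
    rw [(hd x).deriv]
    have := mul_nonneg (sub_nonneg.2 (h x hx)) (Real.exp_pos (-γ * x)).le
    linarith
  have h1 := hm (left_mem_Icc.2 hst) (right_mem_Icc.2 hst) hst
  have h2 := mul_le_mul_of_nonneg_right h1 (Real.exp_pos (γ * t)).le
  simp only [mul_assoc, ← Real.exp_add] at h2
  ring_nf at h2 ⊢
  simpa using h2

lemma le_of_deriv_nonneg_Ioo {f f' : ℝ → ℝ} {s t : ℝ} (hst : s ≤ t)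
    (hf : ∀ x, HasDerivAt f (f' x) x) (h : ∀ x ∈ Ioo s t, 0 ≤ f' x) : f s ≤ f t := by
  simpa using mul_exp_le_of_deriv_ge (γ := 0) hst hf (by simpa using h)

/-- Comparison principle for `(D - β)(D + β)(D - α)(D + α) y₁ = g`: nonnegative data
grow exponentially as long as `g` is nonnegative where `y₁` is. -/
lemma exp_growth_of_factored {α β : ℝ} {y1 y2 y3 y4 g : ℝ → ℝ}
    (h1 : ∀ t, HasDerivAt y1 (y2 t - α * y1 t) t)
    (h2 : ∀ t, HasDerivAt y2 (y3 t + α * y2 t) t)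
    (h3 : ∀ t, HasDerivAt y3 (y4 t - β * y3 t) t)
    (h4 : ∀ t, HasDerivAt y4 (g t + β * y4 t) t)
    (hg : ∀ t, 0 ≤ y1 t → 0 ≤ g t) {s : ℝ}
    (i1 : 0 ≤ y1 s) (i2 : 0 ≤ y2 s) (i3 : 0 ≤ y3 s) (i4 : 0 < y4 s) {t : ℝ} (ht : s ≤ t) :
    y4 s * Real.exp (β * (t - s)) ≤ y4 t := by
  have key : ∀ τ, s ≤ τ → (∀ x ∈ Ico s τ, 0 < y4 x) →
      y4 s * Real.exp (β * (τ - s)) ≤ y4 τ := by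
    intro τ hτ hp
    have step : ∀ {f w : ℝ → ℝ} {γ : ℝ}, (∀ x, HasDerivAt f (w x + γ * f x) x) → 0 ≤ f s →
        (∀ x ∈ Ico s τ, 0 ≤ w x) → ∀ x ∈ Ico s τ, 0 ≤ f x := by
      intro f w γ hf hs hw x hx
      refine le_trans (by positivity) (mul_exp_le_of_deriv_ge (γ := γ) hx.1 hf ?_)
      intro z hz
      have := hw z ⟨hz.1.le, hz.2.trans hx.2⟩
      linarith
    have p3 := step (f := y3) (w := y4) (γ := -β)
      (fun x => by simpa [sub_eq_add_neg] using h3 x) i3 (fun x hx => (hp x hx).le)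
    have p2 := step (f := y2) (w := y3) (γ := α) h2 i2 p3
    have p1 := step (f := y1) (w := y2) (γ := -α)
      (fun x => by simpa [sub_eq_add_neg] using h1 x) i1 p2
    refine mul_exp_le_of_deriv_ge hτ h4 ?_
    intro z hz
    have := hg z (p1 z ⟨hz.1.le, hz.2⟩)
    linarith
  have c4 : Continuous y4 := continuous_iff_continuousAt.2 fun t => (h4 t).continuousAt
  apply key t ht
  by_contra! hcon
  obtain ⟨x, hx, hx4⟩ := hcon
  have hcomp : IsCompact (Icc s x ∩ y4 ⁻¹' Iic 0) :=
    isCompact_Icc.inter_right (isClosed_Iic.preimage c4)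
  obtain ⟨τ, hτ, hmin⟩ := hcomp.exists_isLeast ⟨x, ⟨hx.1, le_rfl⟩, hx4⟩
  have hk := key τ hτ.1.1 (by
    intro z hz
    by_contra! hz4
    exact absurd (hmin ⟨⟨hz.1, hz.2.le.trans hτ.1.2⟩, hz4⟩) (not_le.2 hz.2))
  have : 0 < y4 s * Real.exp (β * (τ - s)) := by positivity
  have h5 : y4 τ ≤ 0 := hτ.2
  linarith

/-- A nonnegative function on the line with `f'' ≤ γ² f` satisfies `f' ≤ γ f`. -/
lemma deriv_le_of_second_deriv_le {f f1 f2 : ℝ → ℝ} {γ : ℝ} (hγ : 0 < γ)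
    (h0 : ∀ t, 0 ≤ f t) (h1 : ∀ t, HasDerivAt f (f1 t) t) (h2 : ∀ t, HasDerivAt f1 (f2 t) t)
    (h : ∀ t, f2 t ≤ γ ^ 2 * f t) (t : ℝ) : f1 t ≤ γ * f t := by
  by_contra! hcon
  set δ := f1 t - γ * f t with hδ
  have hδ0 : 0 < δ := by linarith
  have hy : ∀ s ≤ t, δ ≤ f1 s - γ * f s := by
    intro s hs
    have := mul_exp_le_of_deriv_ge (f := fun x => -(f1 x - γ * f x)) (γ := -γ) hs
      (fun x => ((h2 x).sub ((h1 x).const_mul γ)).neg) (by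
        intro x _
        have := h x
        nlinarith)
    have e1 : Real.exp (-γ * (t - s)) ≤ 1 := by
      apply Real.exp_le_one_iff.2
      nlinarith
    have e2 := Real.exp_pos (-γ * (t - s))
    nlinarith
  have hs : t - (f t + 1) / δ ≤ t := by
    have := h0 t
    have : 0 ≤ (f t + 1) / δ := by positivity
    linarith
  have := le_of_deriv_nonneg_Ioo (f := fun x => f x - δ * x) hs
      (fun x => (h1 x).sub ((hasDerivAt_id x).const_mul δ)) (by
        intro x hx
        have := hy x hx.2.le
        have := mul_nonneg hγ.le (h0 x)
        linarith)
  have e : δ * ((f t + 1) / δ) = f t + 1 := by field_simp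
  have := h0 (t - (f t + 1) / δ)
  nlinarith

lemma HasDerivAt.comp_neg_arg {f : ℝ → ℝ} {f' x : ℝ} (h : HasDerivAt f f' (-x)) :
    HasDerivAt (fun y => f (-y)) (-f') x := by
  simpa [Function.comp_def] using h.comp x (hasDerivAt_neg x)

lemma abs_deriv_le_of_second_deriv_le {f f1 f2 : ℝ → ℝ} {γ : ℝ} (hγ : 0 < γ)
    (h0 : ∀ t, 0 ≤ f t) (h1 : ∀ t, HasDerivAt f (f1 t) t) (h2 : ∀ t, HasDerivAt f1 (f2 t) t)
    (h : ∀ t, f2 t ≤ γ ^ 2 * f t) (t : ℝ) : |f1 t| ≤ γ * f t := by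
  refine abs_le.2 ⟨?_, deriv_le_of_second_deriv_le hγ h0 h1 h2 h t⟩
  have := deriv_le_of_second_deriv_le (f := fun x => f (-x)) (f1 := fun x => -f1 (-x))
    (f2 := fun x => f2 (-x)) hγ (fun x => h0 _)
    (fun x => (h1 (-x)).comp_neg_arg)
    (fun x => by simpa using (h2 (-x)).comp_neg_arg.fun_neg) (fun x => h _) (-t)
  simp only [neg_neg] at this
  linarith

/-- If `f'' = γ² f - r` on the line with `f ≥ 0` and `r > 0` varying at bounded logarithmic rate,
then `f` controls `r`. -/
lemma source_le_of_second_deriv_eq {f f1 r r1 : ℝ → ℝ} {γ ρ : ℝ} (hγ : 0 < γ) (hρ : 0 < ρ)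
    (h0 : ∀ t, 0 ≤ f t) (hr : ∀ t, 0 ≤ r t) (h1 : ∀ t, HasDerivAt f (f1 t) t)
    (h2 : ∀ t, HasDerivAt f1 (γ ^ 2 * f t - r t) t)
    (hr1 : ∀ t, HasDerivAt r (r1 t) t) (hrr : ∀ t, |r1 t| ≤ ρ * r t) (t : ℝ) :
    r t ≤ Real.exp (ρ + γ) * (2 * γ) * f t := by
  have hf : ∀ t, |f1 t| ≤ γ * f t := abs_deriv_le_of_second_deriv_le hγ h0 h1 h2
    (fun t => by linarith [hr t])
  have hlow : ∀ x ∈ Ioo t (t + 1), r t * Real.exp (-ρ) ≤ r x := by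
    intro x hx
    have := mul_exp_le_of_deriv_ge (γ := -ρ) hx.1.le hr1
      (fun z _ => by linarith [(abs_le.1 (hrr z)).1])
    refine le_trans (mul_le_mul_of_nonneg_left (Real.exp_le_exp.2 ?_) (hr t)) this
    nlinarith [hx.1, hx.2]
  have key := le_of_deriv_nonneg_Ioo (s := t) (t := t + 1)
    (f := fun x => -((f1 x + γ * f x) * Real.exp (-γ * (x - t)))
      - r t * Real.exp (-ρ) * Real.exp (-γ) * x) (by linarith)
    (fun x => ((((h2 x).add ((h1 x).const_mul γ)).mul
      ((((hasDerivAt_id x).sub_const t).const_mul (-γ)).exp)).neg).sub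
      ((hasDerivAt_id x).const_mul _)) (by
    intro x hx
    have a1 := hlow x hx
    have a2 : Real.exp (-γ) ≤ Real.exp (-γ * (x - t)) :=
      Real.exp_le_exp.2 (by nlinarith [hx.1, hx.2])
    have a3 : r t * Real.exp (-ρ) * Real.exp (-γ) ≤ r x * Real.exp (-γ * (x - t)) :=
      mul_le_mul a1 a2 (Real.exp_pos _).le (hr x)
    simp only [id, Pi.add_apply]
    linarith)
  simp only [sub_self, mul_zero, Real.exp_zero, mul_one] at key
  have b1 : 0 ≤ (f1 (t + 1) + γ * f (t + 1)) * Real.exp (-γ * (t + 1 - t)) :=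
    mul_nonneg (by linarith [(abs_le.1 (hf (t + 1))).1]) (Real.exp_pos _).le
  have b2 : r t * Real.exp (-ρ) * Real.exp (-γ) ≤ 2 * γ * f t := by
    linarith [(abs_le.1 (hf t)).2]
  have b3 := mul_le_mul_of_nonneg_left b2 (Real.exp_pos (ρ + γ)).le
  have b4 : Real.exp (ρ + γ) * (r t * Real.exp (-ρ) * Real.exp (-γ)) = r t := by
    rw [Real.exp_add, Real.exp_neg, Real.exp_neg]
    field_simp
  linarith

lemma le_of_deriv_nonneg_Icc {f f' : ℝ → ℝ} {s t : ℝ} (hst : s ≤ t)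
    (hf : ∀ x ∈ Icc s t, HasDerivAt f (f' x) x) (h : ∀ x ∈ Icc s t, 0 ≤ f' x) : f s ≤ f t := by
  refine monotoneOn_of_deriv_nonneg (convex_Icc s t)
    (fun x hx => (hf x hx).continuousAt.continuousWithinAt) (fun x hx => ?_) (fun x hx => ?_)
    (left_mem_Icc.2 hst) (right_mem_Icc.2 hst) hst
  · exact (hf x (interior_subset hx)).differentiableAt.differentiableWithinAt
  · rw [(hf x (interior_subset hx)).deriv]
    exact h x (interior_subset hx)

/-- A positive function cannot satisfy `y' ≥ κ y^σ` with `σ > 1` on a half-line. -/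
lemma not_superlinear_growth {y y1 : ℝ → ℝ} {κ σ s : ℝ} (hκ : 0 < κ) (hσ : 1 < σ)
    (hy : ∀ t ≥ s, 0 < y t) (hd : ∀ t ≥ s, HasDerivAt y (y1 t) t)
    (h : ∀ t ≥ s, κ * y t ^ σ ≤ y1 t) : False := by
  have hμ : 0 < (σ - 1) * κ := mul_pos (by linarith) hκ
  set t := s + (y s ^ (1 - σ)) / ((σ - 1) * κ) with ht
  have hz : 0 < y s ^ (1 - σ) := Real.rpow_pos_of_pos (hy s le_rfl) _
  have hst : s ≤ t := by
    have : 0 < y s ^ (1 - σ) / ((σ - 1) * κ) := div_pos hz hμ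
    linarith
  have key := le_of_deriv_nonneg_Icc (f := fun x => -(y x ^ (1 - σ)) - (σ - 1) * κ * x) hst
    (fun x hx => (((hd x hx.1).rpow_const (p := 1 - σ) (Or.inl (hy x hx.1).ne')).fun_neg).fun_sub
      ((hasDerivAt_id x).const_mul _)) (by
    intro x hx
    have h1 := h x hx.1
    have h2 : 0 < y x ^ (-σ) := Real.rpow_pos_of_pos (hy x hx.1) _
    have h3 : y x ^ σ * y x ^ (-σ) = 1 := by
      rw [← Real.rpow_add (hy x hx.1)]; simp
    have h4 : 1 - σ - 1 = -σ := by ring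
    rw [h4]
    have h5 := mul_le_mul_of_nonneg_right h1 h2.le
    rw [mul_assoc, h3, mul_one] at h5
    nlinarith)
  have e : (σ - 1) * κ * (t - s) = y s ^ (1 - σ) := by
    rw [ht, add_sub_cancel_left, mul_div_cancel₀ _ hμ.ne']
  have := Real.rpow_pos_of_pos (hy t hst) (1 - σ)
  nlinarith

lemma rpow_mul_le_sq_add {h v p : ℝ} (hp : 1 < p) (hh : 0 < h) (hv : 0 < v) :
    (h * v) ^ (2 * (p + 1) / (p + 3)) ≤ h ^ 2 + v ^ (p + 1) := by
  have hP : 1 < (p + 3) / (p + 1) := by rw [lt_div_iff₀ (by linarith)]; linarith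
  have hQ : 1 < (p + 3) / 2 := by linarith
  have hc : Real.HolderConjugate ((p + 3) / (p + 1)) ((p + 3) / 2) := by
    rw [Real.holderConjugate_iff]
    exact ⟨hP, by field_simp; ring⟩
  have hyo := Real.young_inequality_of_nonneg
    (Real.rpow_nonneg hh.le (2 * (p + 1) / (p + 3)))
    (Real.rpow_nonneg hv.le (2 * (p + 1) / (p + 3))) hc
  rw [← Real.rpow_mul hh.le, ← Real.rpow_mul hv.le, ← Real.mul_rpow hh.le hv.le] at hyo
  have e1 : 2 * (p + 1) / (p + 3) * ((p + 3) / (p + 1)) = 2 := by field_simp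
  have e2 : 2 * (p + 1) / (p + 3) * ((p + 3) / 2) = p + 1 := by field_simp
  rw [e1, e2] at hyo
  refine hyo.trans (add_le_add ?_ ?_)
  · rw [Real.rpow_two]; exact div_le_self (by positivity) hP.le
  · exact div_le_self (by positivity) hQ.le

/-- The system `v'' ≥ h`, `h'' ≥ c v^p` has no increasing positive solution on a half-line. -/
lemma not_superlinear_system {v v1 v2 h h1 h2 : ℝ → ℝ} {c p s : ℝ} (hc : 0 < c) (hp : 1 < p)
    (dv : ∀ t, HasDerivAt v (v1 t) t) (dv1 : ∀ t, HasDerivAt v1 (v2 t) t)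
    (dh : ∀ t, HasDerivAt h (h1 t) t) (dh1 : ∀ t, HasDerivAt h1 (h2 t) t)
    (pv : ∀ t, 0 < v t) (pv1 : ∀ t ≥ s, 0 < v1 t) (ph : ∀ t ≥ s, 0 < h t)
    (ph1 : ∀ t ≥ s, 0 < h1 t) (hv2 : ∀ t ≥ s, h t ≤ v2 t) (hh2 : ∀ t ≥ s, c * v t ^ p ≤ h2 t) :
    False := by
  set F : ℝ → ℝ := fun t => h1 t * v1 t - h t ^ 2 / 2 - c / (p + 1) * v t ^ (p + 1) with hF
  have dF : ∀ t, HasDerivAt F (h2 t * v1 t + h1 t * v2 t - h t * h1 t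
      - c * v t ^ p * v1 t) t := by
    intro t
    have e1 := (dv t).rpow_const (p := p + 1) (Or.inl (pv t).ne')
    have := (((dh1 t).fun_mul (dv1 t)).fun_sub (((dh t).fun_pow 2).div_const 2)).fun_sub
      (e1.const_mul (c / (p + 1)))
    refine this.congr_deriv ?_
    rw [add_sub_cancel_right]
    have : p + 1 ≠ 0 := by linarith
    field_simp
    ring
  have hFm : ∀ t ≥ s, F s ≤ F t := fun t ht => le_of_deriv_nonneg_Icc ht (fun x _ => dF x) (by
    intro x hx
    have a1 := mul_nonneg (sub_nonneg.2 (hh2 x hx.1)) (pv1 x hx.1).le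
    have a2 := mul_nonneg (sub_nonneg.2 (hv2 x hx.1)) (ph1 x hx.1).le
    linarith)
  have hpv : ∀ t, 0 < v t ^ p := fun t => Real.rpow_pos_of_pos (pv t) _
  have hh1m : ∀ t ≥ s, h1 s ≤ h1 t := fun t ht =>
    le_of_deriv_nonneg_Icc ht (fun x _ => dh1 x) (fun x hx =>
      (mul_pos hc (hpv x)).le.trans (hh2 x hx.1))
  have hlin : ∀ t ≥ s, h s + h1 s * (t - s) ≤ h t := by
    intro t ht
    have := le_of_deriv_nonneg_Icc (f := fun x => h x - h1 s * x) ht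
      (fun x _ => (dh x).fun_sub ((hasDerivAt_id x).const_mul (h1 s))) (by
        intro x hx
        have := hh1m x hx.1
        linarith)
    nlinarith
  have hs1 := ph1 s le_rfl
  set r := s + (4 * |F s| + 1) / h1 s with hr
  have hsr : s ≤ r := by
    have : 0 ≤ (4 * |F s| + 1) / h1 s := by positivity
    linarith
  have hbig : ∀ t ≥ r, -F s ≤ h t ^ 2 / 4 := by
    intro t ht
    have a1 := hlin t (hsr.trans ht)
    have a2 : h1 s * ((4 * |F s| + 1) / h1 s) = 4 * |F s| + 1 := by field_simp
    have a3 : h1 s * (r - s) = 4 * |F s| + 1 := by rw [hr, add_sub_cancel_left, a2]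
    have a4 : h1 s * (r - s) ≤ h1 s * (t - s) := by nlinarith
    have a5 := ph s le_rfl
    have a6 := neg_abs_le (F s)
    have a7 := abs_nonneg (F s)
    have a8 : 4 * |F s| + 1 ≤ h t := by linarith
    nlinarith
  set δ := min (1 / 4) (c / (p + 1)) with hδ
  have hδ0 : 0 < δ := lt_min (by norm_num) (div_pos hc (by linarith))
  have hmain : ∀ t ≥ r, δ * (h t ^ 2 + v t ^ (p + 1)) ≤ h1 t * v1 t := by
    intro t ht
    have a1 := hFm t (hsr.trans ht)
    have a2 := hbig t ht
    have a3 : δ * h t ^ 2 ≤ 1 / 4 * h t ^ 2 :=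
      mul_le_mul_of_nonneg_right (min_le_left _ _) (sq_nonneg _)
    have a4 : δ * v t ^ (p + 1) ≤ c / (p + 1) * v t ^ (p + 1) :=
      mul_le_mul_of_nonneg_right (min_le_right _ _) (Real.rpow_nonneg (pv t).le _)
    simp only [hF] at a1 a2
    linarith
  set θ := 2 * (p + 1) / (p + 3) with hθ
  have hθ1 : 1 < θ := by rw [hθ, lt_div_iff₀ (by linarith)]; linarith
  refine not_superlinear_growth (y := fun t => h t * v t) (s := r) (κ := 2 * √δ)
    (σ := (1 + θ) / 2) (by positivity) (by linarith)
    (fun t ht => mul_pos (ph t (hsr.trans ht)) (pv t)) (fun t _ => (dh t).fun_mul (dv t)) ?_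
  intro t ht
  have q1 := ph t (hsr.trans ht)
  have q2 := pv t
  have q3 := ph1 t (hsr.trans ht)
  have q4 := pv1 t (hsr.trans ht)
  have q5 : 0 < h t * v t := mul_pos q1 q2
  refine abs_le_of_sq_le_sq' (?_ : _ ≤ (h1 t * v t + h t * v1 t) ^ 2) (by positivity) |>.2
  have e1 : (2 * √δ * (h t * v t) ^ ((1 + θ) / 2)) ^ 2
      = 4 * δ * ((h t * v t) * (h t * v t) ^ θ) := by
    rw [mul_pow, mul_pow, Real.sq_sqrt hδ0.le, ← Real.rpow_mul_natCast q5.le]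
    push_cast
    rw [div_mul_cancel₀ _ two_ne_zero, Real.rpow_add q5, Real.rpow_one]
    ring
  rw [e1]
  have e2 := rpow_mul_le_sq_add hp q1 q2
  have e3 := hmain t ht
  have e4 : δ * (h t * v t) ^ θ ≤ h1 t * v1 t :=
    (mul_le_mul_of_nonneg_left e2 hδ0.le).trans e3
  have e5 := mul_le_mul_of_nonneg_left e4 q5.le
  nlinarith [sq_nonneg (h1 t * v t - h t * v1 t)]

namespace DelaunaySol

variable {a : ℝ} {v v1 v2 v3 : ℝ → ℝ}

lemma reflect (h : DelaunaySol a v v1 v2 v3) (T : ℝ) :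
    DelaunaySol a (fun t => v (T - t)) (fun t => -v1 (T - t)) (fun t => v2 (T - t))
      (fun t => -v3 (T - t)) := by
  have key : ∀ {f : ℝ → ℝ} {f' x : ℝ}, HasDerivAt f f' (T - x) →
      HasDerivAt (fun y => f (T - y)) (-f') x := by
    intro f f' x hf
    simpa [Function.comp_def] using hf.comp x ((hasDerivAt_id x).const_sub T)
  refine ⟨fun t => h.pos _, fun t => key (h.d0 _), fun t => ?_, fun t => key (h.d2 _),
    fun t => ?_⟩
  · simpa using (key (h.d1 (T - t))).fun_neg
  · simpa using (key (h.d3 (T - t))).fun_neg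

lemma deriv_potential (h : DelaunaySol a v v1 v2 v3) (t : ℝ) :
    HasDerivAt (fun t => a ^ 2 * v t - v2 t) (a ^ 2 * v1 t - v3 t) t :=
  ((h.d0 t).const_mul _).fun_sub (h.d2 t)

lemma deriv_deriv_potential (h : DelaunaySol a v v1 v2 v3) (t : ℝ) :
    HasDerivAt (fun t => a ^ 2 * v1 t - v3 t) ((a + 2) ^ 2 * (a ^ 2 * v t - v2 t)
      - a * (a + 1) * (a + 2) * (a + 3) * v t ^ (1 + 4 / a)) t := by
  refine (((h.d1 t).const_mul _).fun_sub (h.d3 t)).congr_deriv ?_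
  ring

lemma not_neg_of_deriv_nonpos (ha : 0 < a) (h : DelaunaySol a v v1 v2 v3) (s : ℝ)
    (hs : a ^ 2 * v s - v2 s < 0) (hs1 : a ^ 2 * v1 s - v3 s ≤ 0) : False := by
  set w : ℝ → ℝ := fun t => -(a ^ 2 * v t - v2 t) with hw
  set w1 : ℝ → ℝ := fun t => -(a ^ 2 * v1 t - v3 t) with hw1
  set g : ℝ → ℝ := fun t => a * (a + 1) * (a + 2) * (a + 3) * v t ^ (1 + 4 / a) with hg
  have gpos : ∀ t, 0 < g t := fun t => by
    have := Real.rpow_pos_of_pos (h.pos t) (1 + 4 / a)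
    simp only [hg]; positivity
  have dw : ∀ t, HasDerivAt w (w1 t) t := fun t => (h.deriv_potential t).fun_neg
  have dw1 : ∀ t, HasDerivAt w1 ((a + 2) ^ 2 * w t + g t) t := fun t =>
    (h.deriv_deriv_potential t).fun_neg.congr_deriv (by simp only [hw, hg]; ring)
  have hws : 0 < w s := by simp only [hw]; linarith
  have hw1s : 0 ≤ w1 s := by simp only [hw1]; linarith
  have hy : ∀ t ≥ s, 0 < w1 t + (a + 2) * w t := by
    intro t ht
    refine lt_of_lt_of_le ?_ (mul_exp_le_of_deriv_ge (f := fun x => w1 x + (a + 2) * w x)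
      (γ := a + 2) ht
      (fun x => (dw1 x).fun_add ((dw x).const_mul (a + 2))) ?_)
    · positivity
    · intro x _
      have := gpos x
      linarith
  have hwp : ∀ t ≥ s, 0 < w t := by
    intro t ht
    refine lt_of_lt_of_le ?_ (mul_exp_le_of_deriv_ge (γ := -(a + 2)) ht dw ?_)
    · positivity
    · intro x hx
      have := hy x hx.1.le
      linarith
  have hw1m : ∀ x y, s ≤ x → x ≤ y → w1 x ≤ w1 y := fun x y hx hxy =>
    le_of_deriv_nonneg_Icc hxy (fun z _ => dw1 z) (fun z hz => by
      have := hwp z (hx.trans hz.1)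
      have := gpos z
      positivity)
  have hw1n : ∀ t ≥ s, 0 ≤ w1 t := fun t ht => hw1s.trans (hw1m s t le_rfl ht)
  have hw1p : ∀ t ≥ s + 1, 0 < w1 t := by
    intro t ht
    have hle : s + 1 ≤ t := ht
    by_contra! hc
    have hz : ∀ x ∈ Ioo s t, w1 x = 0 := fun x hx =>
      le_antisymm ((hw1m x t hx.1.le hx.2.le).trans hc) (hw1n x hx.1.le)
    have hm : s + 1 / 2 ∈ Ioo s t := ⟨by linarith, by linarith⟩
    have h0 : HasDerivAt w1 0 (s + 1 / 2) := (hasDerivAt_const _ (0 : ℝ)).congr_of_eventuallyEq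
      (by filter_upwards [isOpen_Ioo.mem_nhds hm] with x hx using hz x hx)
    have := h0.unique (dw1 _)
    have := hwp (s + 1 / 2) (by linarith)
    have := gpos (s + 1 / 2)
    have : 0 < (a + 2) ^ 2 * w (s + 1 / 2) + g (s + 1 / 2) := by positivity
    linarith
  have hwm : ∀ t ≥ s, w s ≤ w t := fun t ht =>
    le_of_deriv_nonneg_Icc ht (fun x _ => dw x) (fun x hx => hw1n x hx.1)
  have hv2 : ∀ t ≥ s, w t ≤ v2 t := by
    intro t _
    have := mul_pos (pow_pos ha 2) (h.pos t)
    simp only [hw]; linarith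
  have hv1 : ∀ t ≥ s, v1 s + w s * (t - s) ≤ v1 t := by
    intro t ht
    have := le_of_deriv_nonneg_Icc (f := fun x => v1 x - w s * x) ht
      (fun x _ => (h.d1 x).fun_sub ((hasDerivAt_id x).const_mul (w s))) (by
        intro x hx
        have := hwm x hx.1
        have := hv2 x hx.1
        linarith)
    nlinarith
  have hr : 0 ≤ (|v1 s| + 1) / w s := by positivity
  refine not_superlinear_system (s := s + 1 + (|v1 s| + 1) / w s) (c := a * (a + 1) * (a + 2) * (a + 3))
    (p := 1 + 4 / a) (by positivity) (by have : 0 < 4 / a := by positivity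
                                         linarith) h.d0 h.d1 dw dw1 h.pos ?_ ?_ ?_ ?_ ?_
  · intro t ht
    have ht' : s + 1 + (|v1 s| + 1) / w s ≤ t := ht
    have a1 := hv1 t (by linarith)
    have a2 : w s * ((|v1 s| + 1) / w s) = |v1 s| + 1 := by field_simp
    have a3 : w s * ((|v1 s| + 1) / w s) ≤ w s * (t - s) :=
      mul_le_mul_of_nonneg_left (by linarith) hws.le
    have := neg_abs_le (v1 s)
    linarith
  · exact fun t ht => hwp t (by linarith [show s + 1 + (|v1 s| + 1) / w s ≤ t from ht])
  · exact fun t ht => hw1p t (by linarith [show s + 1 + (|v1 s| + 1) / w s ≤ t from ht])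
  · exact fun t ht => hv2 t (by linarith [show s + 1 + (|v1 s| + 1) / w s ≤ t from ht])
  · intro t ht
    have := hwp t (by linarith [show s + 1 + (|v1 s| + 1) / w s ≤ t from ht])
    have : 0 ≤ (a + 2) ^ 2 * w t := by positivity
    simp only [hg]; linarith

/-- The "superharmonicity" of global positive solutions. -/
lemma potential_nonneg (ha : 0 < a) (h : DelaunaySol a v v1 v2 v3) (t : ℝ) :
    0 ≤ a ^ 2 * v t - v2 t := by
  by_contra! hc
  rcases le_total (a ^ 2 * v1 t - v3 t) 0 with h1 | h1
  · exact h.not_neg_of_deriv_nonpos ha t hc h1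
  · refine (h.reflect (2 * t)).not_neg_of_deriv_nonpos ha t ?_ ?_ <;>
      simp only [show 2 * t - t = t by ring] <;> linarith

lemma abs_d0_le (ha : 0 < a) (h : DelaunaySol a v v1 v2 v3) (t : ℝ) : |v1 t| ≤ a * v t :=
  abs_deriv_le_of_second_deriv_le ha (fun t => (h.pos t).le) h.d0 h.d1
    (fun t => by linarith [h.potential_nonneg ha t]) t

lemma abs_deriv_potential_le (ha : 0 < a) (h : DelaunaySol a v v1 v2 v3) (t : ℝ) :
    |a ^ 2 * v1 t - v3 t| ≤ (a + 2) * (a ^ 2 * v t - v2 t) :=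
  abs_deriv_le_of_second_deriv_le (by linarith) (h.potential_nonneg ha) h.deriv_potential
    h.deriv_deriv_potential (fun t => by
      have := Real.rpow_pos_of_pos (h.pos t) (1 + 4 / a)
      have : 0 ≤ a * (a + 1) * (a + 2) * (a + 3) * v t ^ (1 + 4 / a) := by positivity
      linarith) t

lemma exists_potential_le (ha : 0 < a) (h : DelaunaySol a v v1 v2 v3) :
    ∃ C > 0, ∀ t, a ^ 2 * v t - v2 t ≤ C * v t :=
  ⟨_, by positivity, source_le_of_second_deriv_eq ha (show 0 < a + 2 by linarith)
    (fun t => (h.pos t).le) (h.potential_nonneg ha) h.d0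
    (fun t => by simpa using h.d1 t) h.deriv_potential (h.abs_deriv_potential_le ha)⟩

lemma exists_bound (ha : 0 < a) (h : DelaunaySol a v v1 v2 v3) : ∃ M > 0, ∀ t, v t ≤ M := by
  obtain ⟨C, hC, hk⟩ := h.exists_potential_le ha
  have h4 : 0 < 4 / a := by positivity
  set c := a * (a + 1) * (a + 2) * (a + 3) with hc
  have hc0 : 0 < c := by positivity
  have hsrc := source_le_of_second_deriv_eq (γ := a + 2) (ρ := (1 + 4 / a) * a) (by linarith)
    (by positivity) (h.potential_nonneg ha)
    (r := fun t => c * v t ^ (1 + 4 / a))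
    (r1 := fun t => c * (v1 t * (1 + 4 / a) * v t ^ (1 + 4 / a - 1)))
    (fun t => mul_nonneg hc0.le (Real.rpow_nonneg (h.pos t).le _))
    h.deriv_potential h.deriv_deriv_potential
    (fun t => ((h.d0 t).rpow_const (Or.inl (h.pos t).ne')).const_mul c) (by
      intro t
      have e1 : v t ^ (1 + 4 / a) = v t * v t ^ (1 + 4 / a - 1) := by
        conv_lhs => rw [show 1 + 4 / a = 1 + (1 + 4 / a - 1) by ring, Real.rpow_add (h.pos t),
          Real.rpow_one]
      have e2 := Real.rpow_pos_of_pos (h.pos t) (1 + 4 / a - 1)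
      rw [e1, abs_mul c, abs_of_pos hc0, abs_mul, abs_mul, abs_of_pos e2,
        abs_of_pos (show 0 < 1 + 4 / a by linarith)]
      have := mul_le_mul_of_nonneg_right (h.abs_d0_le ha t)
        (show 0 ≤ c * (1 + 4 / a) * v t ^ (1 + 4 / a - 1) by positivity)
      linarith)
  set K := Real.exp ((1 + 4 / a) * a + (a + 2)) * (2 * (a + 2)) with hK
  have hK0 : 0 < K := by positivity
  refine ⟨(K * C / c) ^ (4 / a)⁻¹, by positivity, fun t => ?_⟩
  rw [Real.le_rpow_inv_iff_of_pos (h.pos t).le (by positivity) h4, le_div_iff₀ hc0]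
  have e1 := hsrc t
  have e2 := mul_le_mul_of_nonneg_left (hk t) hK0.le
  simp only [Real.rpow_add (h.pos t), Real.rpow_one] at e1
  have e3 : v t * (v t ^ (4 / a) * c) ≤ v t * (K * C) := by linarith
  exact le_of_mul_le_mul_left e3 (h.pos t)

/-- All derivatives of a global positive solution are controlled by the solution. -/
lemma exists_derivs_le (ha : 0 < a) (h : DelaunaySol a v v1 v2 v3) :
    ∃ C > 0, ∀ t, |v1 t| ≤ C * v t ∧ |v2 t| ≤ C * v t ∧ |v3 t| ≤ C * v t := by
  obtain ⟨C, hC, hk⟩ := h.exists_potential_le ha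
  refine ⟨a + (a ^ 2 + C) + (a ^ 3 + (a + 2) * C), by positivity, fun t => ?_⟩
  have p := h.pos t
  have b1 := h.abs_d0_le ha t
  have b2 := h.abs_deriv_potential_le ha t
  have b3 := hk t
  have b4 := h.potential_nonneg ha t
  have c1 : 0 ≤ a ^ 2 * v t := by positivity
  have c2 : 0 ≤ C * v t := by positivity
  have c3 : 0 ≤ a ^ 3 * v t := by positivity
  have c4 : 0 ≤ a * v t := by positivity
  have c5 : 0 ≤ (a + 2) * (C * v t) := by positivity
  have d2 : |v2 t| ≤ (a ^ 2 + C) * v t := by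
    rw [abs_le]; constructor <;> linarith
  have d3 : |v3 t| ≤ (a ^ 3 + (a + 2) * C) * v t := by
    have e1 := mul_le_mul_of_nonneg_left b3 (show 0 ≤ a + 2 by linarith)
    have e2 := mul_le_mul_of_nonneg_left b1 (sq_nonneg a)
    have e3 := abs_sub_abs_le_abs_sub (v3 t) (a ^ 2 * v1 t)
    rw [abs_mul, abs_of_nonneg (sq_nonneg a), abs_sub_comm (v3 t)] at e3
    linarith
  exact ⟨by linarith, by linarith, by linarith⟩

end DelaunaySol

/-- Weak maximum principle on the line for functions vanishing at infinity. -/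
lemma nonpos_of_second_deriv_pos {f f1 f2 : ℝ → ℝ} (h1 : ∀ t, HasDerivAt f (f1 t) t)
    (h2 : ∀ t, HasDerivAt f1 (f2 t) t) (hlim : Tendsto f (cocompact ℝ) (𝓝 0))
    (h : ∀ t, f1 t = 0 → 0 < f t → 0 < f2 t) (t : ℝ) : f t ≤ 0 := by
  by_contra! hc
  have hcont : Continuous f := continuous_iff_continuousAt.2 fun t => (h1 t).continuousAt
  obtain ⟨x, hx⟩ := hcont.exists_forall_ge' t
    ((hlim.eventually (gt_mem_nhds hc)).mono fun _ hy => hy.le)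
  have hmax : IsLocalMax f x := Eventually.of_forall hx
  have hx1 : f1 x = 0 := hmax.hasDerivAt_eq_zero (h1 x)
  have hx2 := h x hx1 (hc.trans_le (hx t))
  have hd : deriv f = f1 := funext fun y => (h1 y).deriv
  have hmin : IsLocalMin f x := isLocalMin_of_deriv_deriv_pos
    (by rw [hd, (h2 x).deriv]; exact hx2) (by rw [hd, hx1]) (h1 x).continuousAt
  have heq : ∀ᶠ y in 𝓝 x, f y = f x := by
    filter_upwards [hmin] with y hy using le_antisymm (hx y) hy
  have hd0 : ∀ᶠ y in 𝓝 x, f1 y = 0 := by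
    filter_upwards [heq.eventually_nhds] with y hy
    exact (h1 y).unique ((hasDerivAt_const y (f x)).congr_of_eventuallyEq hy)
  have := (h2 x).unique ((hasDerivAt_const x (0 : ℝ)).congr_of_eventuallyEq hd0)
  linarith

/-- Barbalat's lemma: a convergent function with bounded second derivative has derivative
tending to zero. -/
lemma tendsto_deriv_zero {f f1 f2 : ℝ → ℝ} {ℓ M : ℝ} (h1 : ∀ t, HasDerivAt f (f1 t) t)
    (h2 : ∀ t, HasDerivAt f1 (f2 t) t) (hM : ∀ t, |f2 t| ≤ M)
    (hlim : Tendsto f atTop (𝓝 ℓ)) : Tendsto f1 atTop (𝓝 0) := by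
  have hM0 : 0 ≤ M := (abs_nonneg _).trans (hM 0)
  rw [Metric.tendsto_nhds]
  intro ε hε
  set η := ε / (2 * (M + 1)) with hη
  have hη0 : 0 < η := by positivity
  have hMη : M * η ≤ ε / 2 := by
    rw [hη, mul_div_assoc', div_le_div_iff₀ (by positivity) two_pos]
    nlinarith
  have hdiff : Tendsto (fun t => f (t + η) - f t) atTop (𝓝 0) := by
    simpa using (hlim.comp (tendsto_atTop_add_const_right _ η tendsto_id)).sub hlim
  filter_upwards [Metric.tendsto_nhds.1 hdiff (η * (ε / 2)) (by positivity)] with t ht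
  rw [Real.dist_0_eq_abs] at ht ⊢
  obtain ⟨ξ, hξ, he⟩ := exists_hasDerivAt_eq_slope f f1 (show t < t + η by linarith)
    (fun x _ => (h1 x).continuousAt.continuousWithinAt) (fun x _ => h1 x)
  have e1 : |f1 ξ| < ε / 2 := by
    rw [he, add_sub_cancel_left, abs_div, abs_of_pos hη0, div_lt_iff₀ hη0]
    linarith
  have e2 : |f1 ξ - f1 t| ≤ M * |ξ - t| := by
    have := (convex_univ (𝕜 := ℝ) (E := ℝ)).norm_image_sub_le_of_norm_hasDerivWithin_le
      (f := f1) (f' := f2) (C := M) (fun x _ => (h2 x).hasDerivWithinAt) (fun x _ => hM x)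
      (mem_univ t) (mem_univ ξ)
    simpa using this
  have e3 : M * |ξ - t| ≤ M * η := by
    apply mul_le_mul_of_nonneg_left _ hM0
    rw [abs_of_pos (by linarith [hξ.1])]
    linarith [hξ.2]
  have e4 := abs_sub_abs_le_abs_sub (f1 t) (f1 ξ)
  rw [abs_sub_comm] at e4
  linarith

lemma eq_zero_of_tendsto_of_tendsto_deriv {f f1 : ℝ → ℝ} {ℓ m : ℝ}
    (h1 : ∀ t, HasDerivAt f (f1 t) t) (hlim : Tendsto f atTop (𝓝 ℓ))
    (hlim1 : Tendsto f1 atTop (𝓝 m)) : m = 0 := by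
  have hmv : ∀ t : ℝ, ∃ ξ, t < ξ ∧ f1 ξ = f (t + 1) - f t := by
    intro t
    obtain ⟨ξ, hξ, he⟩ := exists_hasDerivAt_eq_slope f f1 (show t < t + 1 by linarith)
      (fun x _ => (h1 x).continuousAt.continuousWithinAt) (fun x _ => h1 x)
    exact ⟨ξ, hξ.1, by simpa using he⟩
  choose ξ hξ he using hmv
  have hξt : Tendsto ξ atTop atTop := tendsto_atTop_mono (fun t => (hξ t).le) tendsto_id
  have h2 : Tendsto (fun t => f (t + 1) - f t) atTop (𝓝 0) := by
    simpa using (hlim.comp (tendsto_atTop_add_const_right _ (1 : ℝ) tendsto_id)).sub hlim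
  refine tendsto_nhds_unique (hlim1.comp hξt) (h2.congr fun t => ?_)
  simp [he]

/-- A positive bounded function without critical points on a half-line converges. -/
lemma exists_tendsto_of_deriv_ne_zero {f f1 : ℝ → ℝ} {s M : ℝ}
    (h1 : ∀ t, HasDerivAt f (f1 t) t) (hpos : ∀ t, 0 < f t) (hM : ∀ t, f t ≤ M)
    (hne : ∀ t ≥ s, f1 t ≠ 0) : ∃ L, 0 ≤ L ∧ Tendsto f atTop (𝓝 L) := by
  suffices ∃ L, Tendsto f atTop (𝓝 L) by
    obtain ⟨L, hL⟩ := this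
    exact ⟨L, ge_of_tendsto' hL fun t => (hpos t).le, hL⟩
  have heq : (fun t => f (max s t)) =ᶠ[atTop] f := by
    filter_upwards [eventually_ge_atTop s] with t ht
    rw [max_eq_right ht]
  rcases hasDerivWithinAt_forall_lt_or_forall_gt_of_forall_ne (convex_Ici s)
    (fun x _ => (h1 x).hasDerivWithinAt) (m := 0) hne with h | h
  · have hm : Antitone fun t => f (max s t) := by
      intro x y hxy
      have := le_of_deriv_nonneg_Icc (f := fun x => -f x) (max_le_max_left s hxy)
        (fun z _ => (h1 z).fun_neg) (fun z hz => by
          have := h z ((le_max_left s x).trans hz.1)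
          linarith)
      simpa using this
    exact ⟨_, (tendsto_atTop_ciInf hm ⟨0, by rintro _ ⟨t, rfl⟩; exact (hpos _).le⟩).congr' heq⟩
  · have hm : Monotone fun t => f (max s t) := by
      intro x y hxy
      exact le_of_deriv_nonneg_Icc (max_le_max_left s hxy)
        (fun z _ => h1 z) (fun z hz => (h z ((le_max_left s x).trans hz.1)).le)
    exact ⟨_, (tendsto_atTop_ciSup hm ⟨M, by rintro _ ⟨t, rfl⟩; exact hM _⟩).congr' heq⟩

/-- Strict maximality of the positive equilibrium for the potential part of the energy. -/
lemma potential_energy_lt {a x L : ℝ} (ha : 0 < a) (hx : 0 < x) (hL : 0 < L) (hne : x ≠ L)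
    (hLe : (a + 1) * (a + 3) * L ^ (4 / a) = a * (a + 2)) :
    (a + 2) ^ 2 * x ^ 2 - (a + 1) * (a + 3) * (x ^ 2 * x ^ (4 / a)) < 2 * (a + 2) * L ^ 2 := by
  set σ := (x / L) ^ 2 with hσ
  have hσ0 : 0 < σ := by positivity
  have hσ1 : σ - 1 ≠ 0 := by
    intro h
    have h2 : (x / L) ^ 2 = 1 := by linarith
    have h3 : x / L = 1 := (pow_eq_one_iff_of_nonneg (by positivity) two_ne_zero).1 h2
    exact hne (by field_simp at h3; exact h3)
  have hb := one_add_mul_self_lt_rpow_one_add (s := σ - 1) (by linarith) hσ1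
    (p := 1 + 2 / a) (by have : 0 < 2 / a := by positivity
                         linarith)
  rw [add_sub_cancel, Real.rpow_add hσ0, Real.rpow_one] at hb
  have e1 : σ ^ (2 / a) * L ^ (4 / a) = x ^ (4 / a) := by
    rw [hσ, ← Real.rpow_natCast_mul (by positivity)]
    rw [show ((2 : ℕ) : ℝ) * (2 / a) = 4 / a by push_cast; ring,
      ← Real.mul_rpow (by positivity) hL.le, div_mul_cancel₀ _ hL.ne']
  have e2 : σ * L ^ 2 = x ^ 2 := by rw [hσ]; field_simp
  rw [← e1, ← e2]
  have e3 : (a + 1) * (a + 3) * (σ * L ^ 2 * (σ ^ (2 / a) * L ^ (4 / a)))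
      = a * (a + 2) * L ^ 2 * (σ * σ ^ (2 / a)) := by rw [← hLe]; ring
  rw [e3]
  have e4 := mul_lt_mul_of_pos_left hb (show 0 < a * (a + 2) * L ^ 2 by positivity)
  have e5 : a * (a + 2) * L ^ 2 * (1 + (1 + 2 / a) * (σ - 1))
      = a * (a + 2) * L ^ 2 * σ + 2 * (a + 2) * L ^ 2 * (σ - 1) := by
    field_simp; ring
  rw [e5] at e4
  linarith

namespace DelaunaySol

variable {a : ℝ} {v v1 v2 v3 : ℝ → ℝ}

lemma third_deriv_le_of_eq {w w1 w2 w3 : ℝ → ℝ} (ha : 0 < a) (hv : DelaunaySol a v v1 v2 v3)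
    (hw : DelaunaySol a w w1 w2 w3) {T : ℝ} (e0 : v T = w T) (e1 : v1 T = w1 T)
    (e2 : v2 T = w2 T) : v3 T ≤ w3 T := by
  by_contra! hc
  obtain ⟨M, hM, hvM⟩ := hv.exists_bound ha
  obtain ⟨N, hN, hwN⟩ := hw.exists_bound ha
  obtain ⟨C, hC, hvC⟩ := hv.exists_derivs_le ha
  obtain ⟨D, hD, hwD⟩ := hw.exists_derivs_le ha
  set c := a * (a + 1) * (a + 2) * (a + 3) with hcdef
  have hc0 : 0 < c := by positivity
  have h4 : 0 < 4 / a := by positivity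
  set y4 : ℝ → ℝ := fun t => (v3 t - w3 t) - a ^ 2 * (v1 t - w1 t)
      + (a + 2) * ((v2 t - w2 t) - a ^ 2 * (v t - w t)) with hy4
  have key : ∀ t, T ≤ t → y4 T * Real.exp ((a + 2) * (t - T)) ≤ y4 t := by
    intro t ht
    refine exp_growth_of_factored (α := a) (β := a + 2) (y1 := fun t => v t - w t)
      (y2 := fun t => (v1 t - w1 t) + a * (v t - w t))
      (y3 := fun t => (v2 t - w2 t) - a ^ 2 * (v t - w t)) (y4 := y4)
      (g := fun t => c * (v t ^ (1 + 4 / a) - w t ^ (1 + 4 / a))) ?_ ?_ ?_ ?_ ?_ ?_ ?_ ?_ ?_ ht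
    · intro t
      exact ((hv.d0 t).fun_sub (hw.d0 t)).congr_deriv (by ring)
    · intro t
      exact (((hv.d1 t).fun_sub (hw.d1 t)).fun_add
        (((hv.d0 t).fun_sub (hw.d0 t)).const_mul a)).congr_deriv (by ring)
    · intro t
      exact (((hv.d2 t).fun_sub (hw.d2 t)).fun_sub
        (((hv.d0 t).fun_sub (hw.d0 t)).const_mul (a ^ 2))).congr_deriv (by simp only [hy4]; ring)
    · intro t
      exact ((((hv.d3 t).fun_sub (hw.d3 t)).fun_sub
        (((hv.d1 t).fun_sub (hw.d1 t)).const_mul (a ^ 2))).fun_add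
        ((((hv.d2 t).fun_sub (hw.d2 t)).fun_sub
        (((hv.d0 t).fun_sub (hw.d0 t)).const_mul (a ^ 2))).const_mul (a + 2))).congr_deriv
        (by simp only [hy4, hcdef]; ring)
    · intro t ht
      have : w t ^ (1 + 4 / a) ≤ v t ^ (1 + 4 / a) :=
        Real.rpow_le_rpow (hw.pos t).le (by linarith) (by linarith)
      exact mul_nonneg hc0.le (by linarith)
    · simp [e0]
    · simp [e0, e1]
    · simp [e0, e2]
    · simp only [hy4, e0, e1, e2, sub_self, mul_zero, sub_zero, add_zero]
      linarith
  have hy4T : 0 < y4 T := by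
    simp only [hy4, e0, e1, e2, sub_self, mul_zero, sub_zero, add_zero]
    linarith
  have hbd : ∃ B, ∀ t, y4 t ≤ B := by
    refine ⟨(C * M + D * N) + a ^ 2 * (C * M + D * N)
      + (a + 2) * ((C * M + D * N) + a ^ 2 * N), fun t => ?_⟩
    obtain ⟨p1, p2, p3⟩ := hvC t
    obtain ⟨q1, q2, q3⟩ := hwD t
    have r1 := mul_le_mul_of_nonneg_left (hvM t) hC.le
    have r2 := mul_le_mul_of_nonneg_left (hwN t) hD.le
    have s3 : v3 t - w3 t ≤ C * M + D * N := by
      linarith [(abs_le.1 p3).2, (abs_le.1 q3).1]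
    have s1 : -(v1 t - w1 t) ≤ C * M + D * N := by
      linarith [(abs_le.1 p1).1, (abs_le.1 q1).2]
    have s2 : v2 t - w2 t ≤ C * M + D * N := by
      linarith [(abs_le.1 p2).2, (abs_le.1 q2).1]
    have s0 : -(v t - w t) ≤ N := by linarith [hv.pos t, hwN t]
    have t1 := mul_le_mul_of_nonneg_left s1 (sq_nonneg a)
    have t0 := mul_le_mul_of_nonneg_left s0 (sq_nonneg a)
    have t2 := mul_le_mul_of_nonneg_left
      (show (v2 t - w2 t) - a ^ 2 * (v t - w t) ≤ (C * M + D * N) + a ^ 2 * N by linarith)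
      (show 0 ≤ a + 2 by linarith)
    simp only [hy4]
    linarith
  obtain ⟨B, hB⟩ := hbd
  have hBT : 0 < B := hy4T.trans_le (hB T)
  have hq : 0 < B / (y4 T * (a + 2)) := by positivity
  have k1 := key (T + B / (y4 T * (a + 2))) (by linarith)
  have k2 := Real.add_one_le_exp ((a + 2) * (T + B / (y4 T * (a + 2)) - T))
  have k3 : y4 T * ((a + 2) * (T + B / (y4 T * (a + 2)) - T)) = B := by
    rw [add_sub_cancel_left]; field_simp
  have k4 := mul_le_mul_of_nonneg_left k2 hy4T.le
  have k5 := hB (T + B / (y4 T * (a + 2)))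
  linarith

lemma rpow_lipschitz {M p : ℝ} (hp : 1 ≤ p) {x y : ℝ} (hx : 0 < x) (hxM : x ≤ M)
    (hy : 0 < y) (hyM : y ≤ M) : |x ^ p - y ^ p| ≤ p * M ^ (p - 1) * |x - y| := by
  have := (convex_Ioc 0 M).norm_image_sub_le_of_norm_hasDerivWithin_le
    (f := fun x : ℝ => x ^ p) (f' := fun x => p * x ^ (p - 1)) (C := p * M ^ (p - 1))
    (fun z hz => (Real.hasDerivAt_rpow_const (Or.inl hz.1.ne')).hasDerivWithinAt)
    (fun z hz => by
      rw [Real.norm_of_nonneg (mul_nonneg (by linarith) (Real.rpow_nonneg hz.1.le _))]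
      exact mul_le_mul_of_nonneg_left (Real.rpow_le_rpow hz.1.le hz.2 (by linarith))
        (by linarith)) ⟨hy, hyM⟩ ⟨hx, hxM⟩
  simpa using this

lemma gronwall_quadratic_bound {A B Λ d0 d1 d2 d3 g : ℝ} (hA : 0 ≤ A) (hB : 0 ≤ B) (hΛ : 0 ≤ Λ)
    (hg : |g| ≤ Λ * |d0|) :
    2 * (d0 * d1 + d1 * d2 + d2 * d3 + d3 * (A * d2 - B * d0 + g))
      ≤ (2 + A + B + Λ) * (d0 ^ 2 + d1 ^ 2 + d2 ^ 2 + d3 ^ 2) := by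
  have g2 : 2 * (d3 * g) ≤ Λ * (d3 ^ 2 + d0 ^ 2) := by
    have i1 : d3 * g ≤ |d3| * |g| := by rw [← abs_mul]; exact le_abs_self _
    have i2 := mul_le_mul_of_nonneg_left hg (abs_nonneg d3)
    have i3 : 2 * (|d3| * |d0|) ≤ d3 ^ 2 + d0 ^ 2 := by
      have := two_mul_le_add_sq |d3| |d0|
      simp only [sq_abs] at this
      linarith
    have i4 := mul_le_mul_of_nonneg_left i3 hΛ
    linarith
  have g3 : A * (2 * (d3 * d2)) ≤ A * (d3 ^ 2 + d2 ^ 2) :=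
    mul_le_mul_of_nonneg_left (by nlinarith [sq_nonneg (d3 - d2)]) hA
  have g4 : B * (-2 * (d3 * d0)) ≤ B * (d3 ^ 2 + d0 ^ 2) :=
    mul_le_mul_of_nonneg_left (by nlinarith [sq_nonneg (d3 + d0)]) hB
  have g5 : 2 * (d0 * d1 + d1 * d2 + d2 * d3) ≤ 2 * (d0 ^ 2 + d1 ^ 2 + d2 ^ 2 + d3 ^ 2) := by
    nlinarith [sq_nonneg (d0 - d1), sq_nonneg (d1 - d2), sq_nonneg (d2 - d3),
      sq_nonneg d0, sq_nonneg d3]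
  have g7 := mul_nonneg hA (add_nonneg (sq_nonneg d0) (sq_nonneg d1))
  have g8 := mul_nonneg hB (add_nonneg (sq_nonneg d1) (sq_nonneg d2))
  have g9 := mul_nonneg hΛ (add_nonneg (sq_nonneg d1) (sq_nonneg d2))
  linarith

lemma eq_of_initial_eq {w w1 w2 w3 : ℝ → ℝ} (ha : 0 < a) (hv : DelaunaySol a v v1 v2 v3)
    (hw : DelaunaySol a w w1 w2 w3) {T : ℝ} (e0 : v T = w T) (e1 : v1 T = w1 T)
    (e2 : v2 T = w2 T) (e3 : v3 T = w3 T) {t : ℝ} (ht : T ≤ t) : v t = w t := by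
  obtain ⟨M, hM, hvM⟩ := hv.exists_bound ha
  obtain ⟨N, hN, hwN⟩ := hw.exists_bound ha
  set c := a * (a + 1) * (a + 2) * (a + 3) with hcdef
  have hc0 : 0 < c := by positivity
  set p := 1 + 4 / a with hp
  have h4 : 0 < 4 / a := by positivity
  have hp1 : 1 ≤ p := by linarith
  set Λ := c * (p * max M N ^ (p - 1)) with hΛ
  have hmax : 0 < max M N := lt_max_of_lt_left hM
  have hΛ0 : 0 < Λ := by positivity
  have hg : ∀ t, |c * (v t ^ p - w t ^ p)| ≤ Λ * |v t - w t| := by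
    intro t
    rw [abs_mul c, abs_of_pos hc0, hΛ, mul_assoc c]
    exact mul_le_mul_of_nonneg_left (rpow_lipschitz hp1 (hv.pos t)
      ((hvM t).trans (le_max_left _ _)) (hw.pos t) ((hwN t).trans (le_max_right _ _))) hc0.le
  set Q : ℝ → ℝ := fun t =>
    (v t - w t) ^ 2 + (v1 t - w1 t) ^ 2 + (v2 t - w2 t) ^ 2 + (v3 t - w3 t) ^ 2 with hQ
  set A := a ^ 2 + (a + 2) ^ 2 with hA
  set B := a ^ 2 * (a + 2) ^ 2 with hB
  have hA0 : 0 < A := by positivity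
  have hB0 : 0 < B := by positivity
  have dQ : ∀ t, HasDerivAt Q (2 * ((v t - w t) * (v1 t - w1 t) + (v1 t - w1 t) * (v2 t - w2 t)
      + (v2 t - w2 t) * (v3 t - w3 t) + (v3 t - w3 t) * (A * (v2 t - w2 t) - B * (v t - w t)
      + c * (v t ^ p - w t ^ p)))) t := by
    intro t
    refine ((((((hv.d0 t).fun_sub (hw.d0 t)).fun_pow 2).fun_add
      (((hv.d1 t).fun_sub (hw.d1 t)).fun_pow 2)).fun_add
      (((hv.d2 t).fun_sub (hw.d2 t)).fun_pow 2)).fun_add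
      (((hv.d3 t).fun_sub (hw.d3 t)).fun_pow 2)).congr_deriv ?_
    push_cast
    ring
  have key := mul_exp_le_of_deriv_ge (f := fun t => -Q t) (γ := 2 + A + B + Λ) ht
    (fun x => (dQ x).fun_neg) (by
      intro x _
      have := gronwall_quadratic_bound (d1 := v1 x - w1 x) (d2 := v2 x - w2 x)
        (d3 := v3 x - w3 x) hA0.le hB0.le hΛ0.le (hg x)
      simp only [hQ]
      linarith)
  have hQT : Q T = 0 := by simp [hQ, e0, e1, e2, e3]
  rw [hQT] at key
  have : (v t - w t) ^ 2 ≤ 0 := by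
    simp only [hQ] at key
    linarith [sq_nonneg (v1 t - w1 t), sq_nonneg (v2 t - w2 t), sq_nonneg (v3 t - w3 t)]
  have := pow_eq_zero_iff (two_ne_zero) |>.1 (le_antisymm this (sq_nonneg _))
  linarith

/-- A global positive solution is symmetric about each of its critical points. -/
lemma symmetric_of_deriv_eq_zero (ha : 0 < a) (h : DelaunaySol a v v1 v2 v3) {T : ℝ}
    (hT : v1 T = 0) (t : ℝ) : v (2 * T - t) = v t := by
  have hr := h.reflect (2 * T)
  have e : 2 * T - T = T := by ring
  have a1 := h.third_deriv_le_of_eq ha hr (T := T) (by simp [e]) (by simp [e, hT]) (by simp [e])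
  have a2 := hr.third_deriv_le_of_eq ha h (T := T) (by simp [e]) (by simp [e, hT]) (by simp [e])
  have key : ∀ t, T ≤ t → v t = v (2 * T - t) := fun t ht =>
    h.eq_of_initial_eq ha hr (by simp [e]) (by simp [e, hT]) (by simp [e])
      (le_antisymm a1 a2) ht
  rcases le_total T t with ht | ht
  · exact (key t ht).symm
  · have := key (2 * T - t) (by linarith)
    simpa using this

lemma periodic_of_two_critical (ha : 0 < a) (h : DelaunaySol a v v1 v2 v3) {S T : ℝ}
    (hS : v1 S = 0) (hT : v1 T = 0) : Function.Periodic v (2 * (T - S)) := by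
  intro t
  rw [← h.symmetric_of_deriv_eq_zero ha hT, ← h.symmetric_of_deriv_eq_zero ha hS]
  congr 1
  ring

/-- The conserved energy of the Delaunay ODE. -/
lemma energy_const (ha : 0 < a) (h : DelaunaySol a v v1 v2 v3) (s t : ℝ) :
    v1 s * v3 s - v2 s ^ 2 / 2 - (a ^ 2 + (a + 2) ^ 2) / 2 * v1 s ^ 2
      + a ^ 2 / 2 * ((a + 2) ^ 2 * v s ^ 2 - (a + 1) * (a + 3) * (v s ^ 2 * v s ^ (4 / a)))
    = v1 t * v3 t - v2 t ^ 2 / 2 - (a ^ 2 + (a + 2) ^ 2) / 2 * v1 t ^ 2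
      + a ^ 2 / 2 * ((a + 2) ^ 2 * v t ^ 2 - (a + 1) * (a + 3) * (v t ^ 2 * v t ^ (4 / a))) := by
  have hd : ∀ t, HasDerivAt (fun t => v1 t * v3 t - v2 t ^ 2 / 2
      - (a ^ 2 + (a + 2) ^ 2) / 2 * v1 t ^ 2 + a ^ 2 / 2 * ((a + 2) ^ 2 * v t ^ 2
      - (a + 1) * (a + 3) * (v t ^ 2 * v t ^ (4 / a)))) 0 t := by
    intro t
    refine (((((h.d1 t).fun_mul (h.d3 t)).fun_sub (((h.d2 t).fun_pow 2).div_const 2)).fun_sub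
      (((h.d1 t).fun_pow 2).const_mul _)).fun_add
      (((((h.d0 t).fun_pow 2).const_mul _).fun_sub
      ((((h.d0 t).fun_pow 2).fun_mul
        ((h.d0 t).rpow_const (p := 4 / a) (Or.inl (h.pos t).ne'))).const_mul _)).const_mul
        _)).congr_deriv ?_
    have hv := h.pos t
    rw [Real.rpow_add hv, Real.rpow_sub hv, Real.rpow_one]
    field_simp
    push_cast
    ring
  exact is_const_of_deriv_eq_zero (fun x => (hd x).differentiableAt) (fun x => (hd x).deriv) s t

lemma tendsto_derivs (ha : 0 < a) (h : DelaunaySol a v v1 v2 v3) {L : ℝ}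
    (hL : Tendsto v atTop (𝓝 L)) :
    Tendsto v1 atTop (𝓝 0) ∧ Tendsto v2 atTop (𝓝 0) ∧ Tendsto v3 atTop (𝓝 0) := by
  obtain ⟨M, hM, hvM⟩ := h.exists_bound ha
  obtain ⟨C, hC, hvC⟩ := h.exists_derivs_le ha
  have hCM : ∀ t, C * v t ≤ C * M := fun t => mul_le_mul_of_nonneg_left (hvM t) hC.le
  have t1 := tendsto_deriv_zero h.d0 h.d1 (fun t => (hvC t).2.1.trans (hCM t)) hL
  have t2 := tendsto_deriv_zero h.d1 h.d2 (fun t => (hvC t).2.2.trans (hCM t)) t1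
  have h4 : 0 < 4 / a := by positivity
  set A := a ^ 2 + (a + 2) ^ 2 with hA
  set B := a ^ 2 * (a + 2) ^ 2 with hB
  set c := a * (a + 1) * (a + 2) * (a + 3) with hc
  have hA0 : 0 < A := by positivity
  have hB0 : 0 < B := by positivity
  have hc0 : 0 < c := by positivity
  refine ⟨t1, t2, tendsto_deriv_zero (M := A * (C * M) + B * M + c * M ^ (1 + 4 / a)) h.d2 h.d3
    (fun t => ?_) t2⟩
  have e1 : |A * v2 t| ≤ A * (C * M) := by
    rw [abs_mul, abs_of_pos hA0]
    exact mul_le_mul_of_nonneg_left ((hvC t).2.1.trans (hCM t)) hA0.le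
  have e2 : |B * v t| ≤ B * M := by
    rw [abs_mul, abs_of_pos hB0, abs_of_pos (h.pos t)]
    exact mul_le_mul_of_nonneg_left (hvM t) hB0.le
  have e3 : |c * v t ^ (1 + 4 / a)| ≤ c * M ^ (1 + 4 / a) := by
    rw [abs_mul, abs_of_pos hc0, abs_of_pos (Real.rpow_pos_of_pos (h.pos t) _)]
    exact mul_le_mul_of_nonneg_left
      (Real.rpow_le_rpow (h.pos t).le (hvM t) (by linarith)) hc0.le
  exact (abs_add_le _ _).trans (add_le_add ((abs_sub _ _).trans (add_le_add e1 e2)) e3)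

/-- Limits at infinity are equilibria. -/
lemma limit_equilibrium (ha : 0 < a) (h : DelaunaySol a v v1 v2 v3) {L : ℝ} (hL0 : 0 ≤ L)
    (hL : Tendsto v atTop (𝓝 L)) :
    L = 0 ∨ (a + 1) * (a + 3) * L ^ (4 / a) = a * (a + 2) := by
  obtain ⟨_, t2, t3⟩ := h.tendsto_derivs ha hL
  have h4 : 0 < 4 / a := by positivity
  have tp : Tendsto (fun t => v t ^ (1 + 4 / a)) atTop (𝓝 (L ^ (1 + 4 / a))) :=
    hL.rpow_const (Or.inr (by linarith))
  have t4 := ((t2.const_mul (a ^ 2 + (a + 2) ^ 2)).sub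
    (hL.const_mul (a ^ 2 * (a + 2) ^ 2))).add (tp.const_mul (a * (a + 1) * (a + 2) * (a + 3)))
  have := eq_zero_of_tendsto_of_tendsto_deriv h.d3 t3 t4
  rcases hL0.eq_or_lt with h0 | h0
  · exact Or.inl h0.symm
  · right
    rw [Real.rpow_add h0, Real.rpow_one] at this
    have e : a * (a + 2) * L * ((a + 1) * (a + 3) * L ^ (4 / a) - a * (a + 2)) = 0 := by
      linarith
    have hne : a * (a + 2) * L ≠ 0 := by positivity
    have := (mul_eq_zero.1 e).resolve_left hne
    linarith

lemma energy_eq_of_tendsto (ha : 0 < a) (h : DelaunaySol a v v1 v2 v3) {L : ℝ} (hL0 : 0 ≤ L)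
    (hL : Tendsto v atTop (𝓝 L)) (t : ℝ) :
    v1 t * v3 t - v2 t ^ 2 / 2 - (a ^ 2 + (a + 2) ^ 2) / 2 * v1 t ^ 2
      + a ^ 2 / 2 * ((a + 2) ^ 2 * v t ^ 2 - (a + 1) * (a + 3) * (v t ^ 2 * v t ^ (4 / a)))
    = a ^ 2 * (a + 2) * L ^ 2 := by
  obtain ⟨t1, t2, t3⟩ := h.tendsto_derivs ha hL
  have h4 : 0 < 4 / a := by positivity
  have tp : Tendsto (fun t => v t ^ (4 / a)) atTop (𝓝 (L ^ (4 / a))) :=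
    hL.rpow_const (Or.inr h4.le)
  have tE := (((t1.mul t3).sub ((t2.pow 2).div_const 2)).sub
    ((t1.pow 2).const_mul ((a ^ 2 + (a + 2) ^ 2) / 2))).add
    ((((hL.pow 2).const_mul ((a + 2) ^ 2)).sub
      (((hL.pow 2).mul tp).const_mul ((a + 1) * (a + 3)))).const_mul (a ^ 2 / 2))
  have := tendsto_nhds_unique (tE.congr fun s => h.energy_const ha s t) tendsto_const_nhds
  rw [← this]
  rcases h.limit_equilibrium ha hL0 hL with e | e
  · simp [e]
  · linear_combination (-(a ^ 2 / 2) * L ^ 2) * e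

/-- The pointwise algebra behind the maximum principle for
`Z = a² v - v'' - a (a+1) v y`, where `y = v^{2/a}` and the energy vanishes. -/
lemma second_deriv_factor {x x1 x2 x3 y Z : ℝ} (ha : 0 < a) (hx : 0 < x) (hy : 0 < y)
    (hZ : Z = a ^ 2 * x - x2 - a * (a + 1) * (x * y))
    (hZ1 : a ^ 2 * x1 - x3 - (a + 1) * (a + 2) * (y * x1) = 0)
    (hk : 0 ≤ a ^ 2 * x - x2)
    (hE : x1 * x3 - x2 ^ 2 / 2 - (a ^ 2 + (a + 2) ^ 2) / 2 * x1 ^ 2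
      + a ^ 2 / 2 * ((a + 2) ^ 2 * x ^ 2 - (a + 1) * (a + 3) * (x ^ 2 * y ^ 2)) = 0) :
    ∃ W > 0, (a + 2) ^ 2 * (a ^ 2 * x - x2) - a * (a + 1) * (a + 2) * (a + 3) * (x * y ^ 2)
      - (a + 1) * (a + 2) * (y * x2 + 2 / a * (y * x1 / x) * x1) = W * Z ∧
      (Z = 0 → x1 ^ 2 = a ^ 2 * x ^ 2 * (1 - y)) := by
  have hX : (a ^ 2 * x ^ 2 * (1 - y) - x1 ^ 2) * ((a + 1) * (2 + (a + 2) * y))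
      = Z * (Z / 2 - (a ^ 2 * x - a * (a + 1) * (x * y))) := by
    subst hZ
    linear_combination hE + x1 * hZ1
  set P := (a + 1) * (2 + (a + 2) * y) with hP
  have hP0 : 0 < P := by positivity
  set K := 2 * (a + 1) * (a + 2) / a with hK
  have hK0 : 0 < K := by positivity
  have hKa : K * a = 2 * (a + 1) * (a + 2) := by rw [hK]; field_simp
  set W0 := ((a + 2) ^ 2 + (a + 1) * (a + 2) * y) * P
    + K * (y / x) * (Z / 2 - (a ^ 2 * x - a * (a + 1) * (x * y))) with hW0
  have hW0pos : 0 < W0 := by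
    have hZlow : -(a * (a + 1) * (x * y)) ≤ Z := by linarith
    have e1 : K * (y / x) * (-(a ^ 2 * x)) ≤
        K * (y / x) * (Z / 2 - (a ^ 2 * x - a * (a + 1) * (x * y))) := by
      apply mul_le_mul_of_nonneg_left _ (by positivity)
      have : 0 ≤ a * (a + 1) * (x * y) := by positivity
      linarith
    have e2 : K * (y / x) * (-(a ^ 2 * x)) = -(2 * (a + 1) * (a + 2) * a * y) := by
      rw [← hKa]; field_simp
    have e3 : ((a + 2) ^ 2 + (a + 1) * (a + 2) * y) * P - 2 * (a + 1) * (a + 2) * a * y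
        = (a + 1) * (a + 2) * (2 * (a + 2) + (a ^ 2 + 2 * a + 4 + 2 * (a + 1) + 2) * y
          - 2 * y + (a + 1) * (a + 2) * y ^ 2) := by
      rw [hP]; ring
    have e4 : 0 < (a + 1) * (a + 2) * (2 * (a + 2) + (a ^ 2 + 2 * a + 4 + 2 * (a + 1) + 2) * y
          - 2 * y + (a + 1) * (a + 2) * y ^ 2) := by
      have : (a ^ 2 + 2 * a + 4 + 2 * (a + 1) + 2) * y - 2 * y
        = (a ^ 2 + 4 * a + 6) * y := by ring
      have : 0 < (a ^ 2 + 4 * a + 6) * y := by positivity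
      have : 0 < (a + 1) * (a + 2) * y ^ 2 := by positivity
      apply mul_pos (by positivity)
      linarith
    linarith
  refine ⟨W0 / P, div_pos hW0pos hP0, ?_, ?_⟩
  · have e1 : (a + 2) ^ 2 * (a ^ 2 * x - x2) - a * (a + 1) * (a + 2) * (a + 3) * (x * y ^ 2)
      - (a + 1) * (a + 2) * (y * x2 + 2 / a * (y * x1 / x) * x1)
      = ((a + 2) ^ 2 + (a + 1) * (a + 2) * y) * Z
        + K * (y / x) * (a ^ 2 * x ^ 2 * (1 - y) - x1 ^ 2) := by
      rw [hZ, hK]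
      field_simp
      ring
    have e2 : a ^ 2 * x ^ 2 * (1 - y) - x1 ^ 2
        = Z * (Z / 2 - (a ^ 2 * x - a * (a + 1) * (x * y))) / P := by
      rw [← hX, mul_div_assoc, div_self hP0.ne', mul_one]
    rw [e1, e2, hW0]
    field_simp
  · intro h0
    rw [h0, zero_mul] at hX
    have := (mul_eq_zero.1 hX).resolve_right hP0.ne'
    linarith

/-- Solutions decaying at both ends are spherical. -/
lemma spherical_of_tendsto_zero (ha : 0 < a) (h : DelaunaySol a v v1 v2 v3)
    (htop : Tendsto v atTop (𝓝 0)) (hbot : Tendsto v atBot (𝓝 0)) {T : ℝ} (hT : v1 T = 0)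
    (t : ℝ) : v t = Real.cosh (t - T) ^ (-a) := by
  have h2a : 0 < 2 / a := by positivity
  set y : ℝ → ℝ := fun t => v t ^ (2 / a) with hy
  have ypos : ∀ t, 0 < y t := fun t => Real.rpow_pos_of_pos (h.pos t) _
  have dy : ∀ t, HasDerivAt y (2 / a * (y t * v1 t / v t)) t := by
    intro t
    refine ((h.d0 t).rpow_const (p := 2 / a) (Or.inl (h.pos t).ne')).congr_deriv ?_
    rw [Real.rpow_sub (h.pos t), Real.rpow_one]
    ring
  have y4 : ∀ t, v t ^ (4 / a) = y t ^ 2 := by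
    intro t
    rw [hy, ← Real.rpow_mul_natCast (h.pos t).le]
    congr 1
    push_cast; ring
  have dZ : ∀ t, HasDerivAt (fun t => a ^ 2 * v t - v2 t - a * (a + 1) * (v t * y t))
      (a ^ 2 * v1 t - v3 t - (a + 1) * (a + 2) * (y t * v1 t)) t := by
    intro t
    refine ((h.deriv_potential t).fun_sub
      (((h.d0 t).fun_mul (dy t)).const_mul (a * (a + 1)))).congr_deriv ?_
    have := (h.pos t).ne'
    field_simp
  have dZ1 : ∀ t, HasDerivAt (fun t => a ^ 2 * v1 t - v3 t - (a + 1) * (a + 2) * (y t * v1 t))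
      ((a + 2) ^ 2 * (a ^ 2 * v t - v2 t) - a * (a + 1) * (a + 2) * (a + 3) * (v t * y t ^ 2)
      - (a + 1) * (a + 2) * (y t * v2 t + 2 / a * (y t * v1 t / v t) * v1 t)) t := by
    intro t
    refine ((h.deriv_deriv_potential t).fun_sub
      (((dy t).fun_mul (h.d1 t)).const_mul ((a + 1) * (a + 2)))).congr_deriv ?_
    rw [Real.rpow_add (h.pos t), Real.rpow_one, y4]
    ring
  have hE : ∀ t, v1 t * v3 t - v2 t ^ 2 / 2 - (a ^ 2 + (a + 2) ^ 2) / 2 * v1 t ^ 2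
      + a ^ 2 / 2 * ((a + 2) ^ 2 * v t ^ 2 - (a + 1) * (a + 3) * (v t ^ 2 * y t ^ 2)) = 0 := by
    intro t
    rw [← y4, h.energy_eq_of_tendsto ha le_rfl htop t]
    ring
  obtain ⟨C, hC, hvC⟩ := h.exists_derivs_le ha
  have hv0 : Tendsto v (cocompact ℝ) (𝓝 0) := by
    rw [cocompact_eq_atBot_atTop]; exact hbot.sup htop
  have hv20 : Tendsto v2 (cocompact ℝ) (𝓝 0) :=
    squeeze_zero_norm (fun t => (hvC t).2.1) (by simpa using hv0.const_mul C)
  have hy0 : Tendsto y (cocompact ℝ) (𝓝 0) := by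
    have := hv0.rpow_const (p := 2 / a) (Or.inr h2a.le)
    rwa [Real.zero_rpow h2a.ne'] at this
  have hZ0 : Tendsto (fun t => a ^ 2 * v t - v2 t - a * (a + 1) * (v t * y t))
      (cocompact ℝ) (𝓝 0) := by
    simpa using ((hv0.const_mul (a ^ 2)).sub hv20).sub ((hv0.mul hy0).const_mul (a * (a + 1)))
  have hfac := fun t (h1 : a ^ 2 * v1 t - v3 t - (a + 1) * (a + 2) * (y t * v1 t) = 0) =>
    second_deriv_factor ha (h.pos t) (ypos t) rfl h1 (h.potential_nonneg ha t) (hE t)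
  have hZ : ∀ t, a ^ 2 * v t - v2 t - a * (a + 1) * (v t * y t) = 0 := by
    intro t
    apply le_antisymm
    · refine nonpos_of_second_deriv_pos dZ dZ1 hZ0 (fun s h1 h2 => ?_) t
      obtain ⟨W, hW, e, -⟩ := hfac s h1
      rw [e]; exact mul_pos hW h2
    · rw [← neg_nonpos]
      refine nonpos_of_second_deriv_pos (fun t => (dZ t).fun_neg) (fun t => (dZ1 t).fun_neg)
        (by simpa using hZ0.neg) (fun s h1 h2 => ?_) t
      obtain ⟨W, hW, e, -⟩ := hfac s (neg_eq_zero.1 h1)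
      rw [e, ← mul_neg]; exact mul_pos hW h2
  have hZ1 : ∀ t, a ^ 2 * v1 t - v3 t - (a + 1) * (a + 2) * (y t * v1 t) = 0 := by
    intro t
    have := dZ t
    simp only [hZ] at this
    exact this.unique (hasDerivAt_const t 0)
  have hX : ∀ t, v1 t ^ 2 = a ^ 2 * v t ^ 2 * (1 - y t) := by
    intro t
    obtain ⟨W, -, -, e⟩ := hfac t (hZ1 t)
    exact e (hZ t)
  set u : ℝ → ℝ := fun t => v t ^ (-a⁻¹) with hu
  set u1 : ℝ → ℝ := fun t => -(u t * v1 t / (a * v t)) with hu1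
  have du : ∀ t, HasDerivAt u (u1 t) t := by
    intro t
    refine ((h.d0 t).rpow_const (p := -a⁻¹) (Or.inl (h.pos t).ne')).congr_deriv ?_
    rw [Real.rpow_sub (h.pos t), Real.rpow_one]
    simp only [hu1, hu]
    field_simp
  have du1 : ∀ t, HasDerivAt u1 (u t) t := by
    intro t
    have hv := (h.pos t).ne'
    have hav : a * v t ≠ 0 := mul_ne_zero ha.ne' hv
    refine ((((du t).fun_mul (h.d1 t)).fun_div ((h.d0 t).const_mul a) hav).fun_neg).congr_deriv ?_
    have e1 := hX t
    have e2 : v2 t = a ^ 2 * v t - a * (a + 1) * (v t * y t) := by linarith [hZ t]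
    simp only [hu1]
    rw [e2]
    field_simp
    linear_combination (u t * (1 + a)) * e1
  have hvT : v T = 1 := by
    have e1 := hX T
    rw [hT] at e1
    have hne : a ^ 2 * v T ^ 2 ≠ 0 := by have := h.pos T; positivity
    have e2 : y T = 1 := by
      have : a ^ 2 * v T ^ 2 * (1 - y T) = 0 := by rw [← e1]; ring
      have := (mul_eq_zero.1 this).resolve_left hne
      linarith
    exact (Real.rpow_left_inj (h.pos T).le zero_le_one h2a.ne').1 (by rw [Real.one_rpow]; exact e2)
  have huT : u T = 1 := by simp [hu, hvT]
  have hu1T : u1 T = 0 := by simp [hu1, hT]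
  have hexp : ∀ ε : ℝ, ε ^ 2 = 1 → ∀ t, (u t + ε * u1 t) * Real.exp (-ε * (t - T)) = 1 := by
    intro ε hε t
    have hd : ∀ t, HasDerivAt (fun t => (u t + ε * u1 t) * Real.exp (-ε * (t - T))) 0 t := by
      intro t
      refine (((du t).fun_add ((du1 t).const_mul ε)).fun_mul
        ((((hasDerivAt_id t).sub_const T).const_mul (-ε)).exp)).congr_deriv ?_
      simp only [id]
      linear_combination (-u1 t * Real.exp (-ε * (t - T))) * hε
    rw [is_const_of_deriv_eq_zero (fun x => (hd x).differentiableAt) (fun x => (hd x).deriv) t T]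
    simp [huT, hu1T]
  have hcosh : u t = Real.cosh (t - T) := by
    have p1 := hexp 1 (by norm_num) t
    have p2 := hexp (-1) (by norm_num) t
    have q : Real.exp (t - T) * Real.exp (-(t - T)) = 1 := by rw [← Real.exp_add]; simp
    simp only [neg_neg, one_mul, neg_mul] at p1 p2
    rw [Real.cosh_eq]
    linear_combination (Real.exp (t - T) / 2) * p1 + (Real.exp (-(t - T)) / 2) * p2
      - (u t) * q
  rw [← hcosh, hu]
  simp only
  rw [← Real.rpow_mul (h.pos t).le, neg_mul_neg, inv_mul_cancel₀ ha.ne', Real.rpow_one]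

theorem classification (ha : 0 < a) (h : DelaunaySol a v v1 v2 v3) :
    (∃ T, ∀ t, v t = Real.cosh (t - T) ^ (-a)) ∨ ∃ T > 0, Function.Periodic v T := by
  by_cases hcrit : ∃ S T, S < T ∧ v1 S = 0 ∧ v1 T = 0
  · obtain ⟨S, T, hST, hS, hT⟩ := hcrit
    exact Or.inr ⟨2 * (T - S), by linarith, h.periodic_of_two_critical ha hS hT⟩
  left
  push Not at hcrit
  obtain ⟨M, hM, hvM⟩ := h.exists_bound ha
  have hr := h.reflect 0
  obtain ⟨s, hs1, hs2⟩ : ∃ s, (∀ t ≥ s, v1 t ≠ 0) ∧ ∀ t ≥ s, v1 (-t) ≠ 0 := by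
    by_cases hex : ∃ T, v1 T = 0
    · obtain ⟨T, hT⟩ := hex
      have b1 := le_abs_self T
      have b2 := neg_abs_le T
      refine ⟨|T| + 1, fun t ht => hcrit T t ?_ hT, fun t ht h0 => hcrit (-t) T ?_ h0 hT⟩ <;>
        linarith [show |T| + 1 ≤ t from ht]
    · push Not at hex
      exact ⟨0, fun t _ => hex t, fun t _ => hex _⟩
  obtain ⟨L, hL0, hL⟩ := exists_tendsto_of_deriv_ne_zero h.d0 h.pos hvM hs1
  obtain ⟨L', hL'0, hL'⟩ := exists_tendsto_of_deriv_ne_zero hr.d0 hr.pos (fun t => hvM _)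
    (s := s) (fun t ht => by simpa using hs2 t ht)
  have hEq : L' = L := by
    have e1 := h.energy_eq_of_tendsto ha hL0 hL 0
    have e2 := hr.energy_eq_of_tendsto ha hL'0 hL' 0
    simp only [sub_zero, neg_mul_neg, neg_sq] at e2
    rw [e1] at e2
    have e3 : a ^ 2 * (a + 2) ≠ 0 := by positivity
    have e4 := mul_left_cancel₀ e3 e2
    exact ((pow_left_inj₀ hL0 hL'0 two_ne_zero).1 e4).symm
  subst hEq
  have hbot : Tendsto v atBot (𝓝 L') := by
    have := hL'.comp tendsto_neg_atBot_atTop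
    simpa [Function.comp_def] using this
  obtain ⟨T, hT⟩ : ∃ T, v1 T = 0 := by
    by_contra! hne
    have hmono : StrictMono v ∨ StrictAnti v := by
      rcases hasDerivWithinAt_forall_lt_or_forall_gt_of_forall_ne convex_univ
        (fun x _ => (h.d0 x).hasDerivWithinAt) (m := 0) (fun x _ => hne x) with hlt | hgt
      · exact Or.inr (strictAnti_of_hasDerivAt_neg h.d0 fun x => hlt x (mem_univ x))
      · exact Or.inl (strictMono_of_hasDerivAt_pos h.d0 fun x => hgt x (mem_univ x))
    rcases hmono with hm | hm
    · have e1 := hm.monotone.ge_of_tendsto hL 1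
      have e2 := hm.monotone.le_of_tendsto hbot 0
      have e3 := hm zero_lt_one
      linarith
    · have e1 := hm.antitone.le_of_tendsto hL 1
      have e2 := hm.antitone.ge_of_tendsto hbot 0
      have e3 := hm zero_lt_one
      linarith
  have hLzero : L' = 0 := by
    by_contra hne
    have hLpos : 0 < L' := lt_of_le_of_ne hL0 (Ne.symm hne)
    have hLe := (h.limit_equilibrium ha hL0 hL).resolve_left hne
    have hvT : v T = L' := by
      by_contra hne
      have e1 := potential_energy_lt ha (h.pos T) hLpos hne hLe
      have e2 := h.energy_eq_of_tendsto ha hL0 hL T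
      rw [hT] at e2
      have e3 := mul_lt_mul_of_pos_left e1 (show 0 < a ^ 2 / 2 by positivity)
      linarith [sq_nonneg (v2 T)]
    have hne' : ∀ x ∈ Ioi T, v1 x ≠ 0 := fun x hx => hcrit T x hx hT
    rcases hasDerivWithinAt_forall_lt_or_forall_gt_of_forall_ne (convex_Ioi T)
      (fun x _ => (h.d0 x).hasDerivWithinAt) (m := 0) hne' with hlt | hgt
    · have hm : StrictAntiOn v (Ici T) := by
        refine strictAntiOn_of_deriv_neg (convex_Ici T)
          (fun x _ => (h.d0 x).continuousAt.continuousWithinAt) (fun x hx => ?_)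
        rw [interior_Ici] at hx
        rw [(h.d0 x).deriv]; exact hlt x hx
      have e1 : v (T + 1) < v T := hm self_mem_Ici (mem_Ici.2 (by linarith)) (by linarith)
      have e2 : L' ≤ v (T + 1) := le_of_tendsto hL (by
        filter_upwards [eventually_ge_atTop (T + 1)] with x hx
        exact hm.antitoneOn (mem_Ici.2 (by linarith)) (mem_Ici.2 (by linarith)) hx)
      linarith
    · have hm : StrictMonoOn v (Ici T) := by
        refine strictMonoOn_of_deriv_pos (convex_Ici T)
          (fun x _ => (h.d0 x).continuousAt.continuousWithinAt) (fun x hx => ?_)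
        rw [interior_Ici] at hx
        rw [(h.d0 x).deriv]; exact hgt x hx
      have e1 : v T < v (T + 1) := hm self_mem_Ici (mem_Ici.2 (by linarith)) (by linarith)
      have e2 : v (T + 1) ≤ L' := ge_of_tendsto hL (by
        filter_upwards [eventually_ge_atTop (T + 1)] with x hx
        exact hm.monotoneOn (mem_Ici.2 (by linarith)) (mem_Ici.2 (by linarith)) hx)
      linarith
  subst hLzero
  exact ⟨T, h.spherical_of_tendsto_zero ha hL hbot hT⟩

end DelaunaySol

/-- A `C⁴` positive solution of the Delaunay ODE, in the parameter `a = (n - 4) / 2`. -/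
lemma DelaunayODE.delaunaySol {n : ℕ} (hn : 5 ≤ n) {v : ℝ → ℝ} (hreg : ContDiff ℝ 4 v)
    (hpos : ∀ t, 0 < v t) (hode : ∀ t, DelaunayODE n v t) :
    DelaunaySol (((n : ℝ) - 4) / 2) v (iteratedDeriv 1 v) (iteratedDeriv 2 v)
      (iteratedDeriv 3 v) := by
  have hd : ∀ k : ℕ, k < 4 → ∀ t, HasDerivAt (iteratedDeriv k v) (iteratedDeriv (k + 1) v t) t := by
    intro k hk t
    rw [iteratedDeriv_succ]
    exact (hreg.differentiable_iteratedDeriv k (by exact_mod_cast hk) t).hasDerivAt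
  refine ⟨hpos, fun t => by simpa using hd 0 (by norm_num) t, hd 1 (by norm_num),
    hd 2 (by norm_num), fun t => (hd 3 (by norm_num) t).congr_deriv ?_⟩
  have h5 : (5 : ℝ) ≤ n := by exact_mod_cast hn
  have hn4 : (n : ℝ) - 4 ≠ 0 := by linarith
  have he : 1 + 4 / (((n : ℝ) - 4) / 2) = ((n : ℝ) + 4) / ((n : ℝ) - 4) := by
    field_simp; ring
  have := hode t
  unfold DelaunayODE at this
  rw [he]
  linear_combination this

/-- Frank–König classification of global positive solutions of the Delaunay
ODE: every C⁴ positive solution on all of ℝ is either a translate of the spherical solution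
`(cosh t)^{(4−n)/2}` or periodic. -/
theorem frank_koenig_classification (n : ℕ) (hn : 5 ≤ n) (v : ℝ → ℝ)
    (hreg : ContDiff ℝ 4 v) (hpos : ∀ t, 0 < v t)
    (hode : ∀ t, DelaunayODE n v t) :
    (∃ T : ℝ, ∀ t : ℝ, v t = Real.cosh (t - T) ^ (((4 : ℝ) - (n : ℝ))/2))
    ∨ (∃ T > 0, Function.Periodic v T) := by
  have h5 : (5 : ℝ) ≤ n := by exact_mod_cast hn
  have := (DelaunayODE.delaunaySol hn hreg hpos hode).classification (by linarith)
  rwa [show -(((n : ℝ) - 4) / 2) = (4 - (n : ℝ)) / 2 by ring] at this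
end

section
/- Let n ≥ 5 be an integer and let ε_n = (n(n−4)/(n²−4))^{(n−4)/8}. For every ε ∈ (0, ε_n) there exists a C⁴ positive periodic solution v : ℝ → (0,∞) of the Delaunay ODE v''''(t) − ((n(n−4)+8)/2) v''(t) + (n²(n−4)²/16) v(t) = (n(n−4)(n²−4)/16) v(t)^{(n+4)/(n−4)} such that v attains its minimum value ε at t = 0 (i.e. v(0) = ε and v(t) ≥ ε for all t), and this solution is unique. -/
/-- The cylindrical necksize `ε_n = (n(n−4)/(n²−4))^{(n−4)/8}`. -/
noncomputable def epsN (n : ℕ) : ℝ :=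
  ((n : ℝ) * ((n : ℝ) - 4) / ((n : ℝ)^2 - 4)) ^ (((n : ℝ) - 4)/8)

namespace Delaunay

open Set Filter Topology
open scoped NNReal

section GlobalExistence

variable {E : Type*} [NormedAddCommGroup E] [NormedSpace ℝ E]

theorem norm_integral_le_exp {h : ℝ → E} {κ M : ℝ} (hκ : 0 < κ) (hM : 0 ≤ M)
    (hh : ∀ s, ‖h s‖ ≤ M * Real.exp (κ * |s|)) (t : ℝ) :
    ‖∫ s in (0 : ℝ)..t, h s‖ ≤ M / κ * Real.exp (κ * |t|) := by
  have key : ∀ k : ℝ → E, (∀ s, ‖k s‖ ≤ M * Real.exp (κ * |s|)) → ∀ t, 0 ≤ t →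
      ‖∫ s in (0 : ℝ)..t, k s‖ ≤ M / κ * Real.exp (κ * t) := by
    intro k hk t ht
    have hint : ∫ s in (0 : ℝ)..t, M * Real.exp (κ * s)
        = M / κ * Real.exp (κ * t) - M / κ * Real.exp (κ * 0) := by
      refine intervalIntegral.integral_eq_sub_of_hasDerivAt
        (f := fun s => M / κ * Real.exp (κ * s)) (fun s _ => ?_)
        (Continuous.intervalIntegrable (by fun_prop) _ _)
      have h1 : HasDerivAt (fun s : ℝ => κ * s) κ s := by
        simpa using (hasDerivAt_id s).const_mul κ
      refine (h1.exp.const_mul (M / κ)).congr_deriv ?_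
      field_simp
    have h2 : ‖∫ s in (0 : ℝ)..t, k s‖ ≤ ∫ s in (0 : ℝ)..t, M * Real.exp (κ * s) := by
      refine intervalIntegral.norm_integral_le_of_norm_le ht ?_
        (Continuous.intervalIntegrable (by fun_prop) _ _)
      refine Eventually.of_forall fun s hs => ?_
      have := hk s
      rwa [abs_of_pos hs.1] at this
    have h3 : 0 ≤ M / κ * Real.exp (κ * 0) := by positivity
    linarith
  rcases le_total 0 t with ht | ht
  · rw [abs_of_nonneg ht]
    exact key h hh t ht
  · have := key (fun s => h (-s)) (fun s => by simpa using hh (-s)) (-t) (by linarith)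
    rw [intervalIntegral.integral_comp_neg (f := h), neg_neg, neg_zero,
      intervalIntegral.integral_symm, norm_neg] at this
    rwa [abs_of_nonpos ht]

variable [CompleteSpace E]

/-- A globally Lipschitz autonomous ODE has a global solution. -/
theorem exists_global_solution {f : E → E} {K : ℝ≥0} (hf : LipschitzWith K f) (x₀ : E) :
    ∃ γ : ℝ → E, γ 0 = x₀ ∧ ∀ t, HasDerivAt γ (f (γ t)) t := by
  obtain ⟨κ, hκd⟩ : ∃ κ : ℝ, κ = 2 * (K + 1) := ⟨_, rfl⟩
  have hκ : 0 < κ := by rw [hκd]; positivity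
  have hfc := hf.continuous
  have hgrow : ∀ Y : BoundedContinuousFunction ℝ E, ∀ s : ℝ,
      ‖f (x₀ + Real.exp (κ * |s|) • Y s)‖ ≤ (‖f x₀‖ + K * ‖Y‖) * Real.exp (κ * |s|) := by
    intro Y s
    have h1 := hf.dist_le_mul (x₀ + Real.exp (κ * |s|) • Y s) x₀
    rw [dist_eq_norm, dist_eq_norm, add_sub_cancel_left, norm_smul, Real.norm_eq_abs,
      abs_of_pos (Real.exp_pos _)] at h1
    have h2 : 1 ≤ Real.exp (κ * |s|) := Real.one_le_exp (by positivity)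
    have h3 := Y.norm_coe_le_norm s
    have h4 := norm_le_norm_add_norm_sub' (f (x₀ + Real.exp (κ * |s|) • Y s)) (f x₀)
    have h5 : (K : ℝ) * (Real.exp (κ * |s|) * ‖Y s‖) ≤ K * (Real.exp (κ * |s|) * ‖Y‖) := by
      gcongr
    nlinarith [norm_nonneg (f x₀)]
  have hcont : ∀ Y : BoundedContinuousFunction ℝ E,
      Continuous fun s : ℝ => f (x₀ + Real.exp (κ * |s|) • Y s) := by
    intro Y
    have := Y.continuous
    fun_prop
  have hprim : ∀ Y : BoundedContinuousFunction ℝ E, ∀ t : ℝ,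
      HasDerivAt (fun t : ℝ => ∫ s in (0 : ℝ)..t, f (x₀ + Real.exp (κ * |s|) • Y s))
        (f (x₀ + Real.exp (κ * |t|) • Y t)) t := fun Y t =>
    (hcont Y).integral_hasStrictDerivAt 0 t |>.hasDerivAt
  have hexp : ∀ (t : ℝ) (x : E) (M : ℝ), ‖x‖ ≤ M * Real.exp (κ * |t|) →
      ‖Real.exp (-(κ * |t|)) • x‖ ≤ M := by
    intro t x M hx
    rw [norm_smul, Real.norm_eq_abs, abs_of_pos (Real.exp_pos _), Real.exp_neg,
      inv_mul_le_iff₀ (Real.exp_pos _), mul_comm]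
    exact hx
  let Φ : BoundedContinuousFunction ℝ E → BoundedContinuousFunction ℝ E := fun Y =>
    BoundedContinuousFunction.ofNormedAddCommGroup
      (fun t : ℝ => Real.exp (-(κ * |t|)) •
        ∫ s in (0 : ℝ)..t, f (x₀ + Real.exp (κ * |s|) • Y s))
      (by
        have : Continuous fun t : ℝ => ∫ s in (0 : ℝ)..t, f (x₀ + Real.exp (κ * |s|) • Y s) :=
          continuous_iff_continuousAt.2 fun t => (hprim Y t).continuousAt
        fun_prop)
      ((‖f x₀‖ + K * ‖Y‖) / κ)
      (fun t => hexp t _ _ (norm_integral_le_exp hκ (by positivity) (hgrow Y) t))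
  have hΦ : ContractingWith (1 / 2) Φ := by
    refine ⟨by rw [← NNReal.coe_lt_coe]; norm_num, LipschitzWith.of_dist_le_mul fun Y Z => ?_⟩
    refine (BoundedContinuousFunction.dist_le (by positivity)).2 fun t => ?_
    change dist (Real.exp (-(κ * |t|)) • ∫ s in (0 : ℝ)..t, f (x₀ + Real.exp (κ * |s|) • Y s))
      (Real.exp (-(κ * |t|)) • ∫ s in (0 : ℝ)..t, f (x₀ + Real.exp (κ * |s|) • Z s)) ≤ _
    rw [dist_eq_norm, ← smul_sub, ← intervalIntegral.integral_sub
      ((hcont Y).intervalIntegrable _ _) ((hcont Z).intervalIntegrable _ _)]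
    have h1 : ∀ s : ℝ, ‖f (x₀ + Real.exp (κ * |s|) • Y s) - f (x₀ + Real.exp (κ * |s|) • Z s)‖
        ≤ K * dist Y Z * Real.exp (κ * |s|) := by
      intro s
      have h2 := hf.dist_le_mul (x₀ + Real.exp (κ * |s|) • Y s) (x₀ + Real.exp (κ * |s|) • Z s)
      rw [dist_add_left, dist_smul₀, Real.norm_eq_abs, abs_of_pos (Real.exp_pos _),
        dist_eq_norm] at h2
      have := BoundedContinuousFunction.dist_coe_le_dist (f := Y) (g := Z) s
      calc _ ≤ K * (Real.exp (κ * |s|) * dist (Y s) (Z s)) := h2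
        _ ≤ K * (Real.exp (κ * |s|) * dist Y Z) := by gcongr
        _ = _ := by ring
    refine (hexp t _ _ (norm_integral_le_exp hκ (by positivity) h1 t)).trans ?_
    rw [div_le_iff₀ hκ, hκd]
    have := dist_nonneg (x := Y) (y := Z)
    simp only [NNReal.coe_div, NNReal.coe_one, NNReal.coe_ofNat]
    nlinarith [K.2]
  obtain ⟨Y, hY, -⟩ := hΦ.exists_fixedPoint 0 (edist_ne_top _ _)
  have hY' : ∀ t : ℝ, Real.exp (κ * |t|) • Y t
      = ∫ s in (0 : ℝ)..t, f (x₀ + Real.exp (κ * |s|) • Y s) := by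
    intro t
    have h1 : Y t = Real.exp (-(κ * |t|)) •
        ∫ s in (0 : ℝ)..t, f (x₀ + Real.exp (κ * |s|) • Y s) :=
      (congrArg (fun Z : BoundedContinuousFunction ℝ E => Z t) hY).symm
    conv_lhs => rw [h1]
    rw [smul_smul, ← Real.exp_add, add_neg_cancel, Real.exp_zero, one_smul]
  refine ⟨fun t => x₀ + Real.exp (κ * |t|) • Y t, ?_, fun t => ?_⟩
  · simpa using hY' 0
  · exact ((hprim Y t).const_add x₀).congr_of_eventuallyEq
      (Eventually.of_forall fun s => congrArg (x₀ + ·) (hY' s))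

end GlobalExistence
theorem hasDerivAt_min_zero_sq {f : ℝ → ℝ} {f' t : ℝ} (hf : HasDerivAt f f' t) :
    HasDerivAt (fun s => min (f s) 0 ^ 2) (2 * min (f t) 0 * f') t := by
  have key : ∀ x : ℝ, HasDerivAt (fun y : ℝ => min y 0 ^ 2) (2 * min x 0) x := by
    intro x
    rw [hasDerivAt_iff_isLittleO]
    have h : (fun y : ℝ => min y 0 ^ 2 - min x 0 ^ 2 - (y - x) • (2 * min x 0))
        =O[𝓝 x] fun y => (y - x) ^ 2 := by
      refine Asymptotics.IsBigO.of_bound 1 (Eventually.of_forall fun y => ?_)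
      rw [one_mul, Real.norm_eq_abs, Real.norm_eq_abs, abs_of_nonneg (sq_nonneg (y - x)),
        smul_eq_mul, abs_le]
      rcases le_total x 0 with hx | hx <;> rcases le_total y 0 with hy | hy <;>
        simp only [min_eq_left, min_eq_right, hx, hy] <;> constructor <;> nlinarith
    refine h.trans_isLittleO ?_
    have := (Asymptotics.isLittleO_pow_id (𝕜 := ℝ) (n := 2) (by norm_num)).comp_tendsto
      (k := fun y : ℝ => y - x) (l' := 𝓝 x) (by
        have : ContinuousAt (fun y : ℝ => y - x) x := by fun_prop
        simpa [ContinuousAt] using this)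
    simpa [Function.comp_def] using this
  exact (key (f t)).comp t hf

theorem nonpos_of_deriv_le_mul {Z Z' : ℝ → ℝ} {k T : ℝ} (hZ : ∀ t, HasDerivAt Z (Z' t) t)
    (h0 : Z 0 ≤ 0) (hle : ∀ t ∈ Icc 0 T, Z' t ≤ k * Z t) : ∀ t ∈ Icc 0 T, Z t ≤ 0 := by
  have hE : ∀ t, HasDerivAt (fun t => Real.exp (-(k * t)) * Z t)
      (Real.exp (-(k * t)) * (Z' t - k * Z t)) t := by
    intro t
    have h1 : HasDerivAt (fun s : ℝ => -(k * s)) (-k) t := by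
      simpa using (hasDerivAt_id t).const_mul (-k)
    exact (h1.exp.mul (hZ t)).congr_deriv (by ring)
  have hanti : AntitoneOn (fun t => Real.exp (-(k * t)) * Z t) (Icc 0 T) := by
    refine antitoneOn_of_hasDerivWithinAt_nonpos (convex_Icc 0 T)
      (fun t _ => (hE t).continuousAt.continuousWithinAt)
      (fun t _ => (hE t).hasDerivWithinAt) fun t ht => ?_
    have := hle t (interior_subset ht)
    exact mul_nonpos_of_nonneg_of_nonpos (Real.exp_pos _).le (by linarith)
  intro t ht
  have h1 := hanti (left_mem_Icc.2 (ht.1.trans ht.2)) ht ht.1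
  simp only [mul_zero, neg_zero, Real.exp_zero, one_mul] at h1
  by_contra! h2
  have := mul_pos (Real.exp_pos (-(k * t))) h2
  linarith

theorem min_mul_le_min_mul_min {x y : ℝ} : min x 0 * y ≤ min x 0 * min y 0 :=
  mul_le_mul_of_nonpos_left (min_le_left y 0) (min_le_right x 0)

/-- Comparison principle for `f'' ≥ k f`. -/
theorem nonneg_of_second_deriv_ge {f f₁ f₂ : ℝ → ℝ} {k T : ℝ} (hk : 0 ≤ k)
    (hf : ∀ t, HasDerivAt f (f₁ t) t) (hf₁ : ∀ t, HasDerivAt f₁ (f₂ t) t)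
    (h0 : 0 ≤ f 0) (h1 : 0 ≤ f₁ 0) (hge : ∀ t ∈ Icc 0 T, k * f t ≤ f₂ t) :
    ∀ t ∈ Icc 0 T, 0 ≤ f t := by
  have hZ := nonpos_of_deriv_le_mul (k := 1 + k) (T := T)
    (fun t => (hasDerivAt_min_zero_sq (hf t)).add (hasDerivAt_min_zero_sq (hf₁ t)))
    (by simp [h0, h1]) (fun t ht => by
      have a1 := @min_mul_le_min_mul_min (f t) (f₁ t)
      have a2 := @min_mul_le_min_mul_min (f₁ t) (f t)
      have a3 : min (f₁ t) 0 * f₂ t ≤ min (f₁ t) 0 * (k * f t) :=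
        mul_le_mul_of_nonpos_left (hge t ht) (min_le_right _ 0)
      have a4 := mul_le_mul_of_nonneg_left a2 hk
      have a5 := sq_nonneg (min (f t) 0 - min (f₁ t) 0)
      have a6 := mul_nonneg hk a5
      simp only [Pi.add_apply]
      linarith)
  intro t ht
  have h2 := hZ t ht
  simp only [Pi.add_apply] at h2
  have h3 : min (f t) 0 = 0 := by nlinarith [sq_nonneg (min (f t) 0), sq_nonneg (min (f₁ t) 0)]
  exact min_eq_right_iff.1 h3

/-- Invariance of the positive cone for the cooperative system
`D'' = lam D + W`, `W'' = mu W + N` with `N ≥ -L D⁻`. -/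
theorem cone_invariant {D D₁ W W₁ N : ℝ → ℝ} {lam mu L : ℝ} (hlam : 0 ≤ lam) (hmu : 0 ≤ mu)
    (hL : 0 ≤ L) (hD : ∀ t, HasDerivAt D (D₁ t) t)
    (hD₁ : ∀ t, HasDerivAt D₁ (lam * D t + W t) t) (hW : ∀ t, HasDerivAt W (W₁ t) t)
    (hW₁ : ∀ t, HasDerivAt W₁ (mu * W t + N t) t) (hN : ∀ t, L * min (D t) 0 ≤ N t)
    (h0 : 0 ≤ D 0) (h1 : 0 ≤ D₁ 0) (h2 : 0 ≤ W 0) (h3 : 0 ≤ W₁ 0) {t : ℝ} (ht : 0 ≤ t) :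
    0 ≤ D t ∧ 0 ≤ D₁ t ∧ 0 ≤ W t ∧ 0 ≤ W₁ t := by
  have hZ := nonpos_of_deriv_le_mul (k := 3 + lam + mu + L) (T := t)
    (fun t => ((hasDerivAt_min_zero_sq (hD t)).add (hasDerivAt_min_zero_sq (hD₁ t))).add
      ((hasDerivAt_min_zero_sq (hW t)).add (hasDerivAt_min_zero_sq (hW₁ t))))
    (by simp [h0, h1, h2, h3]) (fun t _ => by
      have a1 := @min_mul_le_min_mul_min (D t) (D₁ t)
      have a2 := mul_le_mul_of_nonneg_left (@min_mul_le_min_mul_min (D₁ t) (D t)) hlam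
      have a3 := @min_mul_le_min_mul_min (D₁ t) (W t)
      have a4 := @min_mul_le_min_mul_min (W t) (W₁ t)
      have a5 := mul_le_mul_of_nonneg_left (@min_mul_le_min_mul_min (W₁ t) (W t)) hmu
      have a6 : min (W₁ t) 0 * N t ≤ min (W₁ t) 0 * (L * min (D t) 0) :=
        mul_le_mul_of_nonpos_left (hN t) (min_le_right _ 0)
      have key : ∀ c a b d e : ℝ, 0 ≤ c →
          2 * (c * (a * b)) ≤ c * (a ^ 2 + b ^ 2 + (d ^ 2 + e ^ 2)) :=
        fun c a b d e hc => by
          nlinarith [mul_nonneg hc (sq_nonneg (a - b)), mul_nonneg hc (sq_nonneg d),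
            mul_nonneg hc (sq_nonneg e)]
      have b1 := key 1 (min (D t) 0) (min (D₁ t) 0) (min (W t) 0) (min (W₁ t) 0) one_pos.le
      have b2 := key lam (min (D t) 0) (min (D₁ t) 0) (min (W t) 0) (min (W₁ t) 0) hlam
      have b3 := key 1 (min (D₁ t) 0) (min (W t) 0) (min (D t) 0) (min (W₁ t) 0) one_pos.le
      have b4 := key 1 (min (W t) 0) (min (W₁ t) 0) (min (D t) 0) (min (D₁ t) 0) one_pos.le
      have b5 := key mu (min (W t) 0) (min (W₁ t) 0) (min (D t) 0) (min (D₁ t) 0) hmu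
      have b6 := key L (min (D t) 0) (min (W₁ t) 0) (min (D₁ t) 0) (min (W t) 0) hL
      simp only [Pi.add_apply]
      linarith)
  have hz := hZ t (right_mem_Icc.2 ht)
  simp only [Pi.add_apply] at hz
  have s1 := sq_nonneg (min (D t) 0)
  have s2 := sq_nonneg (min (D₁ t) 0)
  have s3 := sq_nonneg (min (W t) 0)
  have s4 := sq_nonneg (min (W₁ t) 0)
  have key : ∀ x : ℝ, min x 0 ^ 2 ≤ 0 → 0 ≤ x := fun x hx =>
    min_eq_right_iff.1 (pow_eq_zero_iff (two_ne_zero) |>.1 (le_antisymm hx (sq_nonneg _)))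
  exact ⟨key _ (by linarith), key _ (by linarith), key _ (by linarith), key _ (by linarith)⟩

theorem eqOn_Ici_zero_of_bounded {D D₁ W W₁ N : ℝ → ℝ} {lam mu L M : ℝ} (hlam : 0 ≤ lam)
    (hmu : 0 ≤ mu) (hL : 0 ≤ L) (hD : ∀ t, HasDerivAt D (D₁ t) t)
    (hD₁ : ∀ t, HasDerivAt D₁ (lam * D t + W t) t) (hW : ∀ t, HasDerivAt W (W₁ t) t)
    (hW₁ : ∀ t, HasDerivAt W₁ (mu * W t + N t) t) (hN : ∀ t, L * min (D t) 0 ≤ N t)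
    (hM : ∀ t, D t ≤ M)
    (h0 : D 0 = 0) (h1 : D₁ 0 = 0) (h2 : 0 ≤ W 0) (h3 : 0 ≤ W₁ 0) {t : ℝ} (ht : 0 ≤ t) :
    D t = 0 := by
  have hc := fun {t : ℝ} (ht : 0 ≤ t) =>
    cone_invariant hlam hmu hL hD hD₁ hW hW₁ hN h0.ge h1.ge h2 h3 ht
  have hmono : MonotoneOn D₁ (Ici 0) := by
    refine monotoneOn_of_hasDerivWithinAt_nonneg (convex_Ici 0)
      (fun t _ => (hD₁ t).continuousAt.continuousWithinAt)
      (fun t _ => (hD₁ t).hasDerivWithinAt) fun t ht => ?_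
    obtain ⟨a, -, b, -⟩ := hc (interior_subset ht : t ∈ Ici (0 : ℝ))
    positivity
  by_contra hne
  have hpos : 0 < D t := lt_of_le_of_ne (hc ht).1 (Ne.symm hne)
  have ht0 : 0 < t := by
    rcases ht.eq_or_lt with h | h
    · exact absurd (h ▸ h0) hne
    · exact h
  obtain ⟨s, hs, hs'⟩ := exists_hasDerivAt_eq_slope D D₁ ht0
    (fun s _ => (hD s).continuousAt.continuousWithinAt) (fun s _ => hD s)
  have hd : 0 < D₁ s := by
    rw [hs', h0]
    exact div_pos (by linarith) (by linarith)
  have hlin : ∀ τ, s ≤ τ → D s + D₁ s * (τ - s) ≤ D τ := by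
    intro τ hτ
    have := (convex_Ici s).mul_sub_le_image_sub_of_le_deriv (f := D) (C := D₁ s)
      (fun t _ => (hD t).continuousAt.continuousWithinAt)
      (fun t _ => (hD t).differentiableAt.differentiableWithinAt)
      (fun t ht => by
        have ht' : s ≤ t := interior_subset ht
        rw [(hD t).deriv]
        exact hmono hs.1.le (hs.1.le.trans ht') ht') s self_mem_Ici τ hτ hτ
    linarith
  have hDs := (hc hs.1.le).1
  have h4 : s ≤ s + (|M| + 1) / D₁ s := by
    have : 0 ≤ (|M| + 1) / D₁ s := by positivity
    linarith
  have h5 := hlin _ h4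
  have h6 : D₁ s * (s + (|M| + 1) / D₁ s - s) = |M| + 1 := by field_simp; ring
  rw [h6] at h5
  linarith [hM (s + (|M| + 1) / D₁ s), le_abs_self M]

theorem eq_zero_of_bounded_of_nonneg {D D₁ W W₁ N : ℝ → ℝ} {lam mu L M : ℝ} (hlam : 0 ≤ lam)
    (hmu : 0 ≤ mu) (hL : 0 ≤ L) (hD : ∀ t, HasDerivAt D (D₁ t) t)
    (hD₁ : ∀ t, HasDerivAt D₁ (lam * D t + W t) t) (hW : ∀ t, HasDerivAt W (W₁ t) t)
    (hW₁ : ∀ t, HasDerivAt W₁ (mu * W t + N t) t) (hN : ∀ t, L * min (D t) 0 ≤ N t)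
    (hM : ∀ t, D t ≤ M)
    (h0 : D 0 = 0) (h1 : D₁ 0 = 0) (h2 : 0 ≤ W 0) (h3 : 0 ≤ W₁ 0) (t : ℝ) :
    D t = 0 := by
  have hright : ∀ t, 0 ≤ t → D t = 0 := fun t ht =>
    eqOn_Ici_zero_of_bounded hlam hmu hL hD hD₁ hW hW₁ hN hM h0 h1 h2 h3 ht
  have hzero : ∀ {f f' : ℝ → ℝ}, (∀ t, HasDerivAt f (f' t) t) → (∀ t, 0 < t → f t = 0) →
      ∀ t, 0 < t → f' t = 0 := fun {f f'} hf h t ht =>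
    (hf t).unique ((hasDerivAt_const t (0 : ℝ)).congr_of_eventuallyEq
      (Filter.eventually_of_mem (Ioi_mem_nhds ht) fun s hs => h s hs))
  have hD1z := hzero hD fun t ht => hright t ht.le
  have hWz : ∀ t, 0 < t → W t = 0 := fun t ht => by
    have := hzero hD₁ hD1z t ht
    rwa [hright t ht.le, mul_zero, zero_add] at this
  have hW1z := hzero hW hWz
  rcases le_total 0 t with ht | ht
  · exact hright t ht
  · have hsub : ∀ t : ℝ, HasDerivAt (fun t : ℝ => 1 - t) (-1) t := fun t => by
      simpa using (hasDerivAt_id t).const_sub 1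
    have hneg : ∀ {f f' : ℝ → ℝ}, (∀ t, HasDerivAt f (f' t) t) →
        ∀ t, HasDerivAt (fun t => f (1 - t)) (-f' (1 - t)) t := fun hf t =>
      ((hf (1 - t)).comp t (hsub t)).congr_deriv (by ring)
    have := eqOn_Ici_zero_of_bounded (D := fun t => D (1 - t)) (D₁ := fun t => -D₁ (1 - t))
      (W := fun t => W (1 - t)) (W₁ := fun t => -W₁ (1 - t)) (N := fun t => N (1 - t))
      hlam hmu hL (hneg hD) (fun t => (hneg hD₁ t).neg.congr_deriv (by ring)) (hneg hW)
      (fun t => (hneg hW₁ t).neg.congr_deriv (by ring)) (fun t => hN (1 - t))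
      (fun t => hM (1 - t)) (by simp [hright]) (by simp [hD1z]) (by simp [hWz])
      (by simp [hW1z]) (t := 1 - t) (by linarith)
    simpa using this

/-- A bounded solution of the linearised difference system whose first component vanishes to
second order at `0` is zero. -/
theorem eq_zero_of_bounded {D D₁ W W₁ N : ℝ → ℝ} {lam mu L M : ℝ} (hlam : 0 ≤ lam)
    (hmu : 0 ≤ mu) (hL : 0 ≤ L) (hD : ∀ t, HasDerivAt D (D₁ t) t)
    (hD₁ : ∀ t, HasDerivAt D₁ (lam * D t + W t) t) (hW : ∀ t, HasDerivAt W (W₁ t) t)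
    (hW₁ : ∀ t, HasDerivAt W₁ (mu * W t + N t) t) (hN : ∀ t, L * min (D t) 0 ≤ N t)
    (hN' : ∀ t, N t ≤ L * max (D t) 0) (hM : ∀ t, |D t| ≤ M)
    (h0 : D 0 = 0) (h1 : D₁ 0 = 0) (t : ℝ) : D t = 0 := by
  have hneg : ∀ {f f' : ℝ → ℝ}, (∀ t, HasDerivAt f (f' t) t) →
      ∀ t, HasDerivAt (fun t => f (-t)) (-f' (-t)) t := fun hf t =>
    ((hf (-t)).comp t (hasDerivAt_neg t)).congr_deriv (by ring)
  have main : ∀ {D D₁ W W₁ N : ℝ → ℝ}, (∀ t, HasDerivAt D (D₁ t) t) →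
      (∀ t, HasDerivAt D₁ (lam * D t + W t) t) → (∀ t, HasDerivAt W (W₁ t) t) →
      (∀ t, HasDerivAt W₁ (mu * W t + N t) t) → (∀ t, L * min (D t) 0 ≤ N t) →
      (∀ t, |D t| ≤ M) → D 0 = 0 → D₁ 0 = 0 → 0 ≤ W 0 → ∀ t, D t = 0 := by
    intro D D₁ W W₁ N hD hD₁ hW hW₁ hN hM h0 h1 h2 t
    rcases le_total 0 (W₁ 0) with h3 | h3
    · exact eq_zero_of_bounded_of_nonneg hlam hmu hL hD hD₁ hW hW₁ hN
        (fun t => (le_abs_self _).trans (hM t)) h0 h1 h2 h3 t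
    · have := eq_zero_of_bounded_of_nonneg (D := fun t => D (-t)) (D₁ := fun t => -D₁ (-t))
        (W := fun t => W (-t)) (W₁ := fun t => -W₁ (-t)) (N := fun t => N (-t))
        hlam hmu hL (hneg hD) (fun t => (hneg hD₁ t).neg.congr_deriv (by ring)) (hneg hW)
        (fun t => (hneg hW₁ t).neg.congr_deriv (by ring)) (fun t => hN (-t))
        (fun t => (le_abs_self _).trans (hM (-t))) (by simpa using h0) (by simpa using h1)
        (by simpa using h2) (by simpa using h3) (-t)
      simpa using this
  rcases le_total 0 (W 0) with h2 | h2
  · exact main hD hD₁ hW hW₁ hN hM h0 h1 h2 t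
  · have := main (D := fun t => -D t) (D₁ := fun t => -D₁ t) (W := fun t => -W t)
      (W₁ := fun t => -W₁ t) (N := fun t => -N t) (fun t => (hD t).neg)
      (fun t => (hD₁ t).neg.congr_deriv (by ring)) (fun t => (hW t).neg)
      (fun t => (hW₁ t).neg.congr_deriv (by ring))
      (fun t => by
        have h4 : min (-D t) 0 = -max (D t) 0 := by rw [← neg_zero, min_neg_neg, neg_zero]
        rw [h4]
        linarith [hN' t])
      (fun t => by rw [abs_neg]; exact hM t) (by simpa using h0) (by simpa using h1)
      (by simpa using h2) t
    simpa using this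

/-- Solutions of the system `u'' = lam u + w`, `w'' = mu w + g(u)`. -/
structure IsSol (lam mu : ℝ) (g u u₁ w w₁ : ℝ → ℝ) : Prop where
  du : ∀ t, HasDerivAt u (u₁ t) t
  du₁ : ∀ t, HasDerivAt u₁ (lam * u t + w t) t
  dw : ∀ t, HasDerivAt w (w₁ t) t
  dw₁ : ∀ t, HasDerivAt w₁ (mu * w t + g (u t)) t

theorem exists_Ioc_neg {f : ℝ → ℝ} {f' s : ℝ} (hf : HasDerivAt f f' s) (h0 : f s = 0)
    (h' : f' < 0) : ∃ δ > 0, ∀ τ ∈ Ioc s (s + δ), f τ < 0 := by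
  have h1 : ∀ᶠ τ in 𝓝[>] s, slope f s τ < 0 :=
    ((hasDerivAt_iff_tendsto_slope.1 hf).mono_left
      (nhdsWithin_mono s fun x hx => ne_of_gt hx)).eventually_lt_const h'
  obtain ⟨c, hc, hc'⟩ := (mem_nhdsGT_iff_exists_Ioc_subset).1 h1
  refine ⟨c - s, sub_pos.2 hc, fun τ hτ => ?_⟩
  have h2 : slope f s τ < 0 := hc' (by simpa using hτ)
  rw [slope_def_field, h0, sub_zero] at h2
  have h3 : 0 < τ - s := sub_pos.2 hτ.1
  rcases div_neg_iff.1 h2 with h | h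
  · linarith
  · exact h.1

theorem exists_Ioc_pos {f : ℝ → ℝ} {f' s : ℝ} (hf : HasDerivAt f f' s) (h0 : f s = 0)
    (h' : 0 < f') : ∃ δ > 0, ∀ τ ∈ Ioc s (s + δ), 0 < f τ := by
  obtain ⟨δ, hδ, h⟩ := exists_Ioc_neg hf.neg (by simp [h0]) (neg_neg_of_pos h')
  exact ⟨δ, hδ, fun τ hτ => by simpa using h τ hτ⟩

theorem strictMonoOn_Icc_of_deriv_pos {f f' : ℝ → ℝ} {a b : ℝ} (hf : ∀ t, HasDerivAt f (f' t) t)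
    (h : ∀ t ∈ Ioo a b, 0 < f' t) : StrictMonoOn f (Icc a b) := by
  refine strictMonoOn_of_deriv_pos (convex_Icc a b)
    (fun t _ => (hf t).continuousAt.continuousWithinAt) fun t ht => ?_
  rw [(hf t).deriv]
  exact h t (by rwa [interior_Icc] at ht)

theorem strictAntiOn_Icc_of_deriv_neg {f f' : ℝ → ℝ} {a b : ℝ} (hf : ∀ t, HasDerivAt f (f' t) t)
    (h : ∀ t ∈ Ioo a b, f' t < 0) : StrictAntiOn f (Icc a b) := by
  refine strictAntiOn_of_deriv_neg (convex_Icc a b)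
    (fun t _ => (hf t).continuousAt.continuousWithinAt) fun t ht => ?_
  rw [(hf t).deriv]
  exact h t (by rwa [interior_Icc] at ht)

namespace IsSol

variable {lam mu : ℝ} {g u u₁ w w₁ : ℝ → ℝ}

theorem exists_w₁_pos (h : IsSol lam mu g u u₁ w w₁) (hmu : 0 ≤ mu) (hg : StrictMono g)
    (hu0 : u₁ 0 = 0) (hw0 : w₁ 0 = 0) (hu2 : 0 < lam * u 0 + w 0)
    (hw2 : 0 ≤ mu * w 0 + g (u 0)) :
    ∃ t > 0, 0 < w₁ t ∧ ∀ τ ∈ Ioc 0 t, 0 < u₁ τ := by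
  obtain ⟨δ, hδ, hp⟩ := exists_Ioc_pos (h.du₁ 0) hu0 hu2
  rw [zero_add] at hp
  refine ⟨δ, hδ, ?_, hp⟩
  have hu : StrictMonoOn u (Icc 0 δ) :=
    strictMonoOn_Icc_of_deriv_pos h.du fun t ht => hp t ⟨ht.1, ht.2.le⟩
  have hw := nonneg_of_second_deriv_ge (f := fun t => w t - w 0) (T := δ) hmu
    (fun t => (h.dw t).sub_const _) h.dw₁ (by simp) hw0.ge (fun t ht => by
      have := hg.monotone (hu.monotoneOn (left_mem_Icc.2 hδ.le) ht ht.1)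
      linarith)
  have := strictMonoOn_Icc_of_deriv_pos (a := 0) (b := δ) h.dw₁ (fun t ht => by
    have h1 := hg (hu (left_mem_Icc.2 hδ.le) (Ioo_subset_Icc_self ht) ht.1)
    have h2 := mul_nonneg hmu (hw t (Ioo_subset_Icc_self ht))
    linarith)
  simpa [hw0] using this (left_mem_Icc.2 hδ.le) (right_mem_Icc.2 hδ.le) hδ

theorem exists_u₁_neg (h : IsSol lam mu g u u₁ w w₁) (hlam : 0 ≤ lam)
    (hu0 : u₁ 0 = 0) (hw0 : w₁ 0 = 0) (hu2 : lam * u 0 + w 0 = 0)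
    (hw2 : mu * w 0 + g (u 0) < 0) :
    ∃ t > 0, u₁ t < 0 ∧ ∀ τ ∈ Ioc 0 t, w₁ τ < 0 := by
  obtain ⟨δ, hδ, hp⟩ := exists_Ioc_neg (h.dw₁ 0) hw0 hw2
  rw [zero_add] at hp
  refine ⟨δ, hδ, ?_, hp⟩
  have hw : StrictAntiOn w (Icc 0 δ) :=
    strictAntiOn_Icc_of_deriv_neg h.dw fun t ht => hp t ⟨ht.1, ht.2.le⟩
  have hu := nonneg_of_second_deriv_ge (f := fun t => u 0 - u t) (T := δ) hlam
    (fun t => (h.du t).const_sub _) (fun t => (h.du₁ t).neg) (by simp) (by simp [hu0])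
    (fun t ht => by
      have := hw.antitoneOn (left_mem_Icc.2 hδ.le) ht ht.1
      linarith)
  have := strictAntiOn_Icc_of_deriv_neg (a := 0) (b := δ) h.du₁ (fun t ht => by
    have h1 := hw (left_mem_Icc.2 hδ.le) (Ioo_subset_Icc_self ht) ht.1
    have h2 := mul_nonneg hlam (hu t (Ioo_subset_Icc_self ht))
    linarith)
  simpa [hu0] using this (left_mem_Icc.2 hδ.le) (right_mem_Icc.2 hδ.le) hδ

/-- `u` cannot increase while `w` decreases for all positive times. -/
theorem not_forall_monotone (h : IsSol lam mu g u u₁ w w₁) (hlam : 0 ≤ lam) (hmu : 0 < mu) {e : ℝ}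
    (hlt : ∀ x ∈ Ico (u 0) e, g x < lam * mu * x)
    (hgt : ∀ c > e, ∃ r > 0, ∀ x ≥ c, lam * mu * x + r ≤ g x)
    (hu : ∀ t > 0, 0 < u₁ t) (hw : ∀ t > 0, w₁ t < 0) : False := by
  have hum : ∀ {s t : ℝ}, 0 ≤ s → s < t → u s < u t := fun {s t} hs hst =>
    strictMonoOn_Icc_of_deriv_pos (a := s) (b := t) h.du
      (fun τ hτ => hu τ (hs.trans_lt hτ.1)) (left_mem_Icc.2 hst.le) (right_mem_Icc.2 hst.le) hst
  have hφ : ∀ t, HasDerivAt (fun t => w t - mu * u t) (w₁ t - mu * u₁ t) t := fun t =>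
    (h.dw t).sub ((h.du t).const_mul mu)
  have hφ₁ : ∀ t, HasDerivAt (fun t => w₁ t - mu * u₁ t) (g (u t) - lam * mu * u t) t := fun t =>
    ((h.dw₁ t).sub ((h.du₁ t).const_mul mu)).congr_deriv (by ring)
  have hφneg : ∀ t > 0, w₁ t - mu * u₁ t < 0 := fun t ht => by
    have := mul_pos hmu (hu t ht)
    linarith [hw t ht]
  by_cases hc : ∃ t₁ > 0, e < u t₁
  · obtain ⟨t₁, ht₁, he⟩ := hc
    obtain ⟨r, hr, hr'⟩ := hgt _ he
    have hlin : ∀ t ≥ t₁, r * (t - t₁) ≤ (w₁ t - mu * u₁ t) - (w₁ t₁ - mu * u₁ t₁) := by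
      intro t ht
      refine (convex_Ici t₁).mul_sub_le_image_sub_of_le_deriv
        (fun t _ => (hφ₁ t).continuousAt.continuousWithinAt)
        (fun t _ => (hφ₁ t).differentiableAt.differentiableWithinAt)
        (fun t ht => ?_) t₁ self_mem_Ici t ht ht
      rw [interior_Ici] at ht
      rw [(hφ₁ t).deriv]
      linarith [hr' (u t) (hum ht₁.le ht).le]
    have h1 : 0 ≤ -(w₁ t₁ - mu * u₁ t₁) / r :=
      div_nonneg (by linarith [hφneg t₁ ht₁]) hr.le
    have h2 := hlin (t₁ + -(w₁ t₁ - mu * u₁ t₁) / r) (by linarith)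
    rw [add_sub_cancel_left, mul_div_cancel₀ _ hr.ne'] at h2
    linarith [hφneg (t₁ + -(w₁ t₁ - mu * u₁ t₁) / r) (by linarith)]
  · push Not at hc
    have hue : ∀ t ≥ 0, u t < e := fun t ht =>
      (hum ht (lt_add_one t)).trans_le (hc (t + 1) (by linarith))
    have hu0 : ∀ t ≥ 0, u 0 ≤ u t := fun t ht => by
      rcases (show (0 : ℝ) ≤ t from ht).eq_or_lt with h | h
      · rw [h]
      · exact (hum le_rfl h).le
    have hanti : ∀ t ≥ 1, w₁ t - mu * u₁ t ≤ w₁ 1 - mu * u₁ 1 := by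
      intro t ht
      refine antitoneOn_of_hasDerivWithinAt_nonpos (convex_Icc 1 t)
        (fun t _ => (hφ₁ t).continuousAt.continuousWithinAt)
        (fun t _ => (hφ₁ t).hasDerivWithinAt) (fun τ hτ => ?_)
        (left_mem_Icc.2 ht) (right_mem_Icc.2 ht) ht
      rw [interior_Icc] at hτ
      have hτ0 : (0 : ℝ) ≤ τ := by linarith [hτ.1]
      linarith [hlt (u τ) ⟨hu0 τ hτ0, hue τ hτ0⟩]
    obtain ⟨κ, hκ⟩ : ∃ κ, κ = -(w₁ 1 - mu * u₁ 1) := ⟨_, rfl⟩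
    have hκ0 : 0 < κ := by linarith [hφneg 1 one_pos]
    have hlin : ∀ t ≥ 1, w t - mu * u t - (w 1 - mu * u 1) ≤ -κ * (t - 1) := by
      intro t ht
      refine (convex_Ici 1).image_sub_le_mul_sub_of_deriv_le
        (fun t _ => (hφ t).continuousAt.continuousWithinAt)
        (fun t _ => (hφ t).differentiableAt.differentiableWithinAt)
        (fun t ht => ?_) 1 self_mem_Ici t ht ht
      rw [interior_Ici] at ht
      rw [(hφ t).deriv]
      linarith [hanti t (le_of_lt ht)]
    obtain ⟨Q, hQ⟩ : ∃ Q, Q = |w 1 - mu * u 1 + (lam + mu) * e| + 1 := ⟨_, rfl⟩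
    have hQ0 : 0 < Q := by rw [hQ]; positivity
    obtain ⟨t₂, ht₂⟩ : ∃ t₂, t₂ = 1 + Q / κ := ⟨_, rfl⟩
    have ht₂1 : 1 ≤ t₂ := by
      have : 0 < Q / κ := by positivity
      linarith
    have hcv : ∀ t ≥ t₂, lam * u t + w t ≤ -1 := by
      intro t ht
      have h1 := hlin t (ht₂1.trans ht)
      have h2 : κ * (t₂ - 1) = Q := by rw [ht₂]; field_simp; ring
      have h3 : κ * (t₂ - 1) ≤ κ * (t - 1) := mul_le_mul_of_nonneg_left (by linarith) hκ0.le
      have h4 : (lam + mu) * u t ≤ (lam + mu) * e :=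
        mul_le_mul_of_nonneg_left (hue t (by linarith)).le (by linarith)
      have h5 := le_abs_self (w 1 - mu * u 1 + (lam + mu) * e)
      linarith
    have hfin : ∀ t ≥ t₂, u₁ t - u₁ t₂ ≤ -1 * (t - t₂) := by
      intro t ht
      refine (convex_Ici t₂).image_sub_le_mul_sub_of_deriv_le
        (fun t _ => (h.du₁ t).continuousAt.continuousWithinAt)
        (fun t _ => (h.du₁ t).differentiableAt.differentiableWithinAt)
        (fun t ht => ?_) t₂ self_mem_Ici t ht ht
      rw [interior_Ici] at ht
      rw [(h.du₁ t).deriv]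
      exact hcv t (le_of_lt ht)
    have h1 := hu t₂ (by linarith)
    have h2 := hfin (t₂ + u₁ t₂) (by linarith)
    linarith [hu (t₂ + u₁ t₂) (by linarith)]

theorem second_deriv_u_neg (h : IsSol lam mu g u u₁ w w₁) (hlam : 0 ≤ lam) {s : ℝ} (hs : 0 < s)
    (hu : ∀ t ∈ Ioo 0 s, 0 < u₁ t) (hw : ∀ t ∈ Ioo 0 s, w₁ t < 0) (hus : u₁ s = 0) :
    lam * u s + w s < 0 := by
  by_contra! h2
  have hsub : ∀ t : ℝ, HasDerivAt (fun t : ℝ => s - t) (-1) t := fun t => by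
    simpa using (hasDerivAt_id t).const_sub s
  have hum := strictMonoOn_Icc_of_deriv_pos h.du hu
  have hwm := strictAntiOn_Icc_of_deriv_neg h.dw hw
  have := nonneg_of_second_deriv_ge (f := fun t => u (s - t) - u s) (f₁ := fun t => -u₁ (s - t))
    (f₂ := fun t => lam * u (s - t) + w (s - t)) (T := s) hlam
    (fun t => (((h.du (s - t)).comp t (hsub t)).sub_const _).congr_deriv (by ring))
    (fun t => ((h.du₁ (s - t)).comp t (hsub t)).neg.congr_deriv (by ring)) (by simp)
    (by simp [hus]) (fun t ht => by
      have := hwm.antitoneOn (⟨by linarith [ht.2], by linarith [ht.1]⟩ : s - t ∈ Icc 0 s)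
        (right_mem_Icc.2 hs.le) (by linarith [ht.1])
      linarith) s (right_mem_Icc.2 hs.le)
  have h3 := hum (left_mem_Icc.2 hs.le) (right_mem_Icc.2 hs.le) hs
  simp only [sub_self] at this
  linarith

theorem second_deriv_w_pos (h : IsSol lam mu g u u₁ w w₁) (hmu : 0 ≤ mu) (hg : StrictMono g)
    {s : ℝ} (hs : 0 < s) (hu : ∀ t ∈ Ioo 0 s, 0 < u₁ t) (hw : ∀ t ∈ Ioo 0 s, w₁ t < 0)
    (hws : w₁ s = 0) : 0 < mu * w s + g (u s) := by
  by_contra! h2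
  have hsub : ∀ t : ℝ, HasDerivAt (fun t : ℝ => s - t) (-1) t := fun t => by
    simpa using (hasDerivAt_id t).const_sub s
  have hum := strictMonoOn_Icc_of_deriv_pos h.du hu
  have hwm := strictAntiOn_Icc_of_deriv_neg h.dw hw
  have := nonneg_of_second_deriv_ge (f := fun t => w s - w (s - t)) (f₁ := fun t => w₁ (s - t))
    (f₂ := fun t => -(mu * w (s - t) + g (u (s - t)))) (T := s) hmu
    (fun t => (((h.dw (s - t)).comp t (hsub t)).const_sub _).congr_deriv (by ring))
    (fun t => ((h.dw₁ (s - t)).comp t (hsub t)).congr_deriv (by ring)) (by simp)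
    (by simp [hws]) (fun t ht => by
      have := hg.monotone (hum.monotoneOn
        (⟨by linarith [ht.2], by linarith [ht.1]⟩ : s - t ∈ Icc 0 s)
        (right_mem_Icc.2 hs.le) (by linarith [ht.1]))
      linarith) s (right_mem_Icc.2 hs.le)
  have h3 := hwm (left_mem_Icc.2 hs.le) (right_mem_Icc.2 hs.le) hs
  simp only [sub_self] at this
  linarith

theorem continuous_u₁ (h : IsSol lam mu g u u₁ w w₁) : Continuous u₁ :=
  continuous_iff_continuousAt.2 fun t => (h.du₁ t).continuousAt

theorem continuous_w₁ (h : IsSol lam mu g u u₁ w w₁) : Continuous w₁ :=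
  continuous_iff_continuousAt.2 fun t => (h.dw₁ t).continuousAt

/-- If neither `u'` nor `w'` changes sign before the other one, both vanish simultaneously. -/
theorem exists_common_zero (h : IsSol lam mu g u u₁ w w₁) (hlam : 0 ≤ lam) (hmu : 0 < mu)
    (hg : StrictMono g) {e : ℝ} (hlt : ∀ x ∈ Ico (u 0) e, g x < lam * mu * x)
    (hgt : ∀ c > e, ∃ r > 0, ∀ x ≥ c, lam * mu * x + r ≤ g x)
    (hu0 : u₁ 0 = 0) (hw0 : w₁ 0 = 0) (hu2 : 0 < lam * u 0 + w 0)
    (hw2 : mu * w 0 + g (u 0) < 0)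
    (hA : ¬ ∃ t > 0, u₁ t < 0 ∧ ∀ τ ∈ Ioc 0 t, w₁ τ < 0)
    (hB : ¬ ∃ t > 0, 0 < w₁ t ∧ ∀ τ ∈ Ioc 0 t, 0 < u₁ τ) :
    ∃ s > 0, u₁ s = 0 ∧ w₁ s = 0 ∧ ∀ t ∈ Ioo 0 s, 0 < u₁ t := by
  obtain ⟨δ₁, hδ₁, hp₁⟩ := exists_Ioc_pos (h.du₁ 0) hu0 hu2
  obtain ⟨δ₂, hδ₂, hp₂⟩ := exists_Ioc_neg (h.dw₁ 0) hw0 hw2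
  obtain ⟨δ, hδ⟩ : ∃ δ, δ = min δ₁ δ₂ := ⟨_, rfl⟩
  have hδ0 : 0 < δ := hδ ▸ lt_min hδ₁ hδ₂
  have hδ1 : δ ≤ δ₁ := hδ ▸ min_le_left _ _
  have hδ2 : δ ≤ δ₂ := hδ ▸ min_le_right _ _
  obtain ⟨S, hS⟩ : ∃ S : Set ℝ, S = {t | δ ≤ t ∧ (u₁ t ≤ 0 ∨ 0 ≤ w₁ t)} := ⟨_, rfl⟩
  have hSc : IsClosed S := by
    rw [hS]
    exact isClosed_Ici.inter ((isClosed_le h.continuous_u₁ continuous_const).union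
      (isClosed_le continuous_const h.continuous_w₁))
  have hSne : S.Nonempty := by
    by_contra hne
    rw [Set.not_nonempty_iff_eq_empty] at hne
    have hn : ∀ t > 0, 0 < u₁ t ∧ w₁ t < 0 := by
      intro t ht
      rcases le_total t δ with h1 | h1
      · exact ⟨hp₁ t ⟨ht, by linarith⟩, hp₂ t ⟨ht, by linarith⟩⟩
      · by_contra hcon
        have : t ∈ S := by
          rw [hS]
          refine ⟨h1, ?_⟩
          by_contra! h3
          exact hcon h3
        rw [hne] at this
        exact this
    exact h.not_forall_monotone hlam hmu hlt hgt (fun t ht => (hn t ht).1) fun t ht => (hn t ht).2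
  have hSb : BddBelow S := ⟨δ, fun t ht => by rw [hS] at ht; exact ht.1⟩
  obtain ⟨s, hsd⟩ : ∃ s, s = sInf S := ⟨_, rfl⟩
  have hsS : s ∈ S := hsd ▸ hSc.csInf_mem hSne hSb
  have hsS' := hsS
  rw [hS] at hsS'
  have hs0 : 0 < s := hδ0.trans_le hsS'.1
  have hbefore : ∀ t ∈ Ioo 0 s, 0 < u₁ t ∧ w₁ t < 0 := by
    intro t ht
    rcases le_total t δ with h1 | h1
    · exact ⟨hp₁ t ⟨ht.1, by linarith⟩, hp₂ t ⟨ht.1, by linarith⟩⟩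
    · by_contra hcon
      have : t ∈ S := by
        rw [hS]
        refine ⟨h1, ?_⟩
        by_contra! h3
        exact hcon h3
      have := csInf_le hSb this
      linarith [ht.2]
  have hcl : s ∈ closure (Ioo 0 s) := by
    rw [closure_Ioo hs0.ne]
    exact right_mem_Icc.2 hs0.le
  have hus : 0 ≤ u₁ s :=
    closure_minimal (fun t ht => (hbefore t ht).1.le : Ioo 0 s ⊆ {t | 0 ≤ u₁ t})
      (isClosed_le continuous_const h.continuous_u₁) hcl
  have hws : w₁ s ≤ 0 :=
    closure_minimal (fun t ht => (hbefore t ht).2.le : Ioo 0 s ⊆ {t | w₁ t ≤ 0})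
      (isClosed_le h.continuous_w₁ continuous_const) hcl
  refine ⟨s, hs0, ?_, ?_, fun t ht => (hbefore t ht).1⟩
  · by_contra hne
    have hup : 0 < u₁ s := lt_of_le_of_ne hus (Ne.symm hne)
    have hwz : w₁ s = 0 := le_antisymm hws (hsS'.2.resolve_left (not_le.2 hup))
    have h2 := h.second_deriv_w_pos hmu.le hg hs0 (fun t ht => (hbefore t ht).1)
      (fun t ht => (hbefore t ht).2) hwz
    obtain ⟨η, hη, hpos⟩ := exists_Ioc_pos (h.dw₁ s) hwz h2
    obtain ⟨b, hb, hb'⟩ := mem_nhdsGE_iff_exists_Icc_subset.1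
      (mem_nhdsWithin_of_mem_nhds
        (h.continuous_u₁.continuousAt.preimage_mem_nhds (Ioi_mem_nhds hup)))
    refine hB ⟨min b (s + η), by linarith [lt_min hb (by linarith : s < s + η)], ?_, ?_⟩
    · exact hpos _ ⟨lt_min hb (by linarith), min_le_right _ _⟩
    · intro τ hτ
      rcases lt_or_ge τ s with h3 | h3
      · exact (hbefore τ ⟨hτ.1, h3⟩).1
      · exact hb' ⟨h3, hτ.2.trans (min_le_left _ _)⟩
  · by_contra hne
    have hwn : w₁ s < 0 := lt_of_le_of_ne hws hne
    have huz : u₁ s = 0 := le_antisymm (hsS'.2.resolve_right (not_le.2 hwn)) hus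
    have h2 := h.second_deriv_u_neg hlam hs0 (fun t ht => (hbefore t ht).1)
      (fun t ht => (hbefore t ht).2) huz
    obtain ⟨η, hη, hneg⟩ := exists_Ioc_neg (h.du₁ s) huz h2
    obtain ⟨b, hb, hb'⟩ := mem_nhdsGE_iff_exists_Icc_subset.1
      (mem_nhdsWithin_of_mem_nhds
        (h.continuous_w₁.continuousAt.preimage_mem_nhds (Iio_mem_nhds hwn)))
    refine hA ⟨min b (s + η), by linarith [lt_min hb (by linarith : s < s + η)], ?_, ?_⟩
    · exact hneg _ ⟨lt_min hb (by linarith), min_le_right _ _⟩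
    · intro τ hτ
      rcases lt_or_ge τ s with h3 | h3
      · exact (hbefore τ ⟨hτ.1, h3⟩).2
      · exact hb' ⟨h3, hτ.2.trans (min_le_left _ _)⟩

end IsSol

/-- The vector field of the first-order system equivalent to `IsSol`. -/
def field (lam mu : ℝ) (g : ℝ → ℝ) (p : ℝ × ℝ × ℝ × ℝ) : ℝ × ℝ × ℝ × ℝ :=
  (p.2.1, lam * p.1 + p.2.2.1, p.2.2.2, mu * p.2.2.1 + g p.1)

theorem exists_lipschitzWith_field (lam mu : ℝ) {g : ℝ → ℝ} {Kg : ℝ≥0}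
    (hg : LipschitzWith Kg g) : ∃ K, LipschitzWith K (field lam mu g) := by
  have h1 : LipschitzWith _ fun p : ℝ × ℝ × ℝ × ℝ => p.1 := LipschitzWith.prod_fst
  have h2 : LipschitzWith _ fun p : ℝ × ℝ × ℝ × ℝ => p.2.1 :=
    LipschitzWith.prod_fst.comp LipschitzWith.prod_snd
  have h3 : LipschitzWith _ fun p : ℝ × ℝ × ℝ × ℝ => p.2.2.1 :=
    (LipschitzWith.prod_fst.comp LipschitzWith.prod_snd).comp LipschitzWith.prod_snd
  have h4 : LipschitzWith _ fun p : ℝ × ℝ × ℝ × ℝ => p.2.2.2 :=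
    (LipschitzWith.prod_snd.comp LipschitzWith.prod_snd).comp LipschitzWith.prod_snd
  exact ⟨_, h2.prodMk ((((lipschitzWith_smul lam).comp h1).add h3).prodMk
    (h4.prodMk (((lipschitzWith_smul mu).comp h3).add (hg.comp h1))))⟩

theorem isSol_of_hasDerivAt {lam mu : ℝ} {g : ℝ → ℝ} {γ : ℝ → ℝ × ℝ × ℝ × ℝ}
    (hγ : ∀ t, HasDerivAt γ (field lam mu g (γ t)) t) :
    IsSol lam mu g (fun t => (γ t).1) (fun t => (γ t).2.1) (fun t => (γ t).2.2.1)
      (fun t => (γ t).2.2.2) where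
  du t := (hγ t).fst
  du₁ t := (hγ t).snd.fst
  dw t := (hγ t).snd.snd.fst
  dw₁ t := (hγ t).snd.snd.snd

namespace IsSol

variable {lam mu : ℝ} {g u u₁ w w₁ v v₁ z z₁ : ℝ → ℝ}

theorem hasDerivAt_field (h : IsSol lam mu g u u₁ w w₁) (t : ℝ) :
    HasDerivAt (fun t => (u t, u₁ t, w t, w₁ t)) (field lam mu g (u t, u₁ t, w t, w₁ t)) t :=
  (h.du t).prodMk ((h.du₁ t).prodMk ((h.dw t).prodMk (h.dw₁ t)))

theorem unique {Kg : ℝ≥0} (hg : LipschitzWith Kg g) (h : IsSol lam mu g u u₁ w w₁)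
    (h' : IsSol lam mu g v v₁ z z₁) {t₀ : ℝ} (h0 : u t₀ = v t₀) (h1 : u₁ t₀ = v₁ t₀)
    (h2 : w t₀ = z t₀) (h3 : w₁ t₀ = z₁ t₀) : u = v := by
  obtain ⟨K, hK⟩ := exists_lipschitzWith_field lam mu hg
  have := ODE_solution_unique_univ (v := fun _ => field lam mu g) (K := K) (s := fun _ => univ)
    (t₀ := t₀) (fun _ => hK.lipschitzOnWith) (fun t => ⟨h.hasDerivAt_field t, mem_univ _⟩)
    (fun t => ⟨h'.hasDerivAt_field t, mem_univ _⟩) (by simp [h0, h1, h2, h3])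
  exact funext fun t => congrArg Prod.fst (congrFun this t)

theorem reflect (h : IsSol lam mu g u u₁ w w₁) (c : ℝ) :
    IsSol lam mu g (fun t => u (c - t)) (fun t => -u₁ (c - t)) (fun t => w (c - t))
      (fun t => -w₁ (c - t)) := by
  have hsub : ∀ t : ℝ, HasDerivAt (fun t : ℝ => c - t) (-1) t := fun t => by
    simpa using (hasDerivAt_id t).const_sub c
  exact
    { du := fun t => ((h.du (c - t)).comp t (hsub t)).congr_deriv (by ring)
      du₁ := fun t => ((h.du₁ (c - t)).comp t (hsub t)).neg.congr_deriv (by ring)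
      dw := fun t => ((h.dw (c - t)).comp t (hsub t)).congr_deriv (by ring)
      dw₁ := fun t => ((h.dw₁ (c - t)).comp t (hsub t)).neg.congr_deriv (by ring) }

theorem reflect_eq {Kg : ℝ≥0} (hg : LipschitzWith Kg g) (h : IsSol lam mu g u u₁ w w₁) {s : ℝ}
    (hu : u₁ s = 0) (hw : w₁ s = 0) (t : ℝ) : u (2 * s - t) = u t := by
  have hs : 2 * s - s = s := by ring
  exact congrFun ((h.reflect (2 * s)).unique hg h (t₀ := s) (by simp [hs]) (by simp [hs, hu])
    (by simp [hs]) (by simp [hs, hw])) t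

theorem periodic {Kg : ℝ≥0} (hg : LipschitzWith Kg g) (h : IsSol lam mu g u u₁ w w₁) {s : ℝ}
    (hu0 : u₁ 0 = 0) (hw0 : w₁ 0 = 0) (hu : u₁ s = 0) (hw : w₁ s = 0) :
    Function.Periodic u (2 * s) := by
  intro t
  have h1 := h.reflect_eq hg hu hw (-t)
  have h2 := h.reflect_eq hg hu0 hw0 t
  simp only [mul_zero, zero_sub] at h2
  rw [← h2, ← h1]
  congr 1
  ring

theorem mem_Icc {Kg : ℝ≥0} (hg : LipschitzWith Kg g) (h : IsSol lam mu g u u₁ w w₁) {s : ℝ}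
    (hs : 0 < s) (hu0 : u₁ 0 = 0) (hw0 : w₁ 0 = 0) (hu : u₁ s = 0) (hw : w₁ s = 0)
    (hpos : ∀ t ∈ Ioo 0 s, 0 < u₁ t) (t : ℝ) : u t ∈ Icc (u 0) (u s) := by
  have hmono := (strictMonoOn_Icc_of_deriv_pos h.du hpos).monotoneOn
  have hI : ∀ t ∈ Icc 0 s, u t ∈ Icc (u 0) (u s) := fun t ht =>
    ⟨hmono (left_mem_Icc.2 hs.le) ht ht.1, hmono ht (right_mem_Icc.2 hs.le) ht.2⟩
  obtain ⟨t', ht', htt⟩ := (h.periodic hg hu0 hw0 hu hw).exists_mem_Ico₀ (by linarith) t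
  rw [htt]
  rcases le_total t' s with h1 | h1
  · exact hI t' ⟨ht'.1, h1⟩
  · rw [← h.reflect_eq hg hu hw t']
    exact hI _ ⟨by linarith [ht'.2], by linarith⟩

/-- Conservation of energy between two critical points of `u`. -/
theorem energy (h : IsSol lam mu g u u₁ w w₁) {F : ℝ → ℝ}
    (hF : ∀ x, HasDerivAt F (lam * mu * x - g x) x) {s : ℝ} (hu0 : u₁ 0 = 0) (hu : u₁ s = 0) :
    F (u 0) - (lam * u 0 + w 0) ^ 2 / 2 ≤ F (u s) := by
  have hE : ∀ t, HasDerivAt (fun t => u₁ t * w₁ t + (lam - mu) / 2 * u₁ t ^ 2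
      - (lam * u t + w t) ^ 2 / 2 + F (u t)) 0 t := by
    intro t
    refine (((((h.du₁ t).mul (h.dw₁ t)).add (((h.du₁ t).pow 2).const_mul ((lam - mu) / 2))).sub
      (((((h.du t).const_mul lam).add (h.dw t)).pow 2).div_const 2)).add
      ((hF (u t)).comp t (h.du t))).congr_deriv ?_
    simp only [Pi.add_apply]
    ring
  have := is_const_of_deriv_eq_zero (fun t => (hE t).differentiableAt) (fun t => (hE t).deriv) 0 s
  simp only [hu0, hu] at this
  nlinarith [sq_nonneg (lam * u s + w s)]

end IsSol

/-- The one-parameter family of solutions with `u(0) = ε`, `u''(0) = α` and vanishing odd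
derivatives at `0`, with its Lipschitz dependence on `α`. -/
theorem exists_family (lam mu ε : ℝ) {g : ℝ → ℝ} {Kg : ℝ≥0} (hg : LipschitzWith Kg g) :
    ∃ u u₁ w w₁ : ℝ → ℝ → ℝ,
      (∀ α, IsSol lam mu g (u α) (u₁ α) (w α) (w₁ α) ∧ u α 0 = ε ∧ u₁ α 0 = 0
        ∧ w α 0 = α - lam * ε ∧ w₁ α 0 = 0) ∧
      ∀ T, ∃ C ≥ 0, ∀ α β, ∀ t ∈ Icc 0 T,
        |u α t - u β t| ≤ C * |α - β| ∧ |w α t - w β t| ≤ C * |α - β| := by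
  obtain ⟨K, hK⟩ := exists_lipschitzWith_field lam mu hg
  choose γ hγ0 hγ using fun α : ℝ => exists_global_solution hK (ε, 0, α - lam * ε, 0)
  refine ⟨fun α t => (γ α t).1, fun α t => (γ α t).2.1, fun α t => (γ α t).2.2.1,
    fun α t => (γ α t).2.2.2, fun α => ⟨isSol_of_hasDerivAt (hγ α), by simp [hγ0], by simp [hγ0],
      by simp [hγ0], by simp [hγ0]⟩, fun T => ⟨Real.exp (K * T), (Real.exp_pos _).le, ?_⟩⟩
  intro α β t ht
  have h0 : dist (γ α 0) (γ β 0) ≤ |α - β| := by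
    simp [hγ0, Prod.dist_eq, Real.dist_eq]
  have h1 := dist_le_of_trajectories_ODE (v := fun _ => field lam mu g) (K := K) (fun _ => hK)
    (fun t _ => (hγ α t).continuousAt.continuousWithinAt) (fun t _ => (hγ α t).hasDerivWithinAt)
    (fun t _ => (hγ β t).continuousAt.continuousWithinAt) (fun t _ => (hγ β t).hasDerivWithinAt)
    h0 t ht
  have h2 : |α - β| * Real.exp (K * (t - 0)) ≤ Real.exp (K * T) * |α - β| := by
    rw [mul_comm, sub_zero]
    have := ht.2
    gcongr
  simp only [Prod.dist_eq, Real.dist_eq] at h1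
  have h3 := h1.trans h2
  simp only [max_le_iff] at h3
  exact ⟨h3.1, h3.2.2.1⟩

/-- Openness in the parameter of the condition `f α < 0` on `(0, T]`, for functions vanishing
at `0` with negative derivative there. -/
theorem eventually_forall_Ioc_neg {f f' : ℝ → ℝ → ℝ} {T C α : ℝ} (hT : 0 < T) (_ : 0 ≤ C)
    (hf : ∀ β t, HasDerivAt (f β) (f' β t) t) (h0 : ∀ β, f β 0 = 0)
    (hlip : ∀ β, ∀ t ∈ Icc 0 T, |f' β t - f' α t| ≤ C * |β - α|) (h' : f' α 0 < 0)
    (hneg : ∀ t ∈ Ioc 0 T, f α t < 0) : ∀ᶠ β in 𝓝 α, ∀ t ∈ Ioc 0 T, f β t < 0 := by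
  have hcont : ContinuousOn (dslope (f α) 0) (Icc 0 T) := fun t _ => by
    refine ContinuousAt.continuousWithinAt ?_
    rcases eq_or_ne t 0 with rfl | ht
    · exact continuousAt_dslope_same.2 (hf α 0).differentiableAt
    · exact (continuousAt_dslope_of_ne ht).2 (hf α t).continuousAt
  obtain ⟨m, hm, hmax⟩ := isCompact_Icc.exists_isMaxOn (nonempty_Icc.2 hT.le) hcont
  have hds : ∀ t ∈ Ioc 0 T, dslope (f α) 0 t = f α t / t := fun t ht => by
    rw [dslope_of_ne _ ht.1.ne', slope_def_field, h0, sub_zero, sub_zero]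
  have hm0 : dslope (f α) 0 m < 0 := by
    rcases hm.1.eq_or_lt with h | h
    · rw [← h, dslope_same, (hf α 0).deriv]
      exact h'
    · rw [hds m ⟨h, hm.2⟩]
      exact div_neg_of_neg_of_pos (hneg m ⟨h, hm.2⟩) h
  have hev : ∀ᶠ β in 𝓝 α, C * |β - α| < -dslope (f α) 0 m := by
    have : ContinuousAt (fun β => C * |β - α|) α := by fun_prop
    exact this.eventually_lt_const (by simpa using hm0)
  filter_upwards [hev] with β hβ t ht
  have h1 : f α t ≤ dslope (f α) 0 m * t := by
    have h2 : dslope (f α) 0 t ≤ dslope (f α) 0 m := hmax ⟨ht.1.le, ht.2⟩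
    rwa [hds t ht, div_le_iff₀ ht.1] at h2
  have h2 : (f β t - f α t) - (f β 0 - f α 0) ≤ C * |β - α| * (t - 0) := by
    refine (convex_Icc 0 t).image_sub_le_mul_sub_of_deriv_le (f := fun t => f β t - f α t)
      (fun t _ => ((hf β t).sub (hf α t)).continuousAt.continuousWithinAt)
      (fun t _ => ((hf β t).sub (hf α t)).differentiableAt.differentiableWithinAt)
      (fun τ hτ => ?_) 0 (left_mem_Icc.2 ht.1.le) t (right_mem_Icc.2 ht.1.le) ht.1.le
    rw [interior_Icc] at hτ
    have h3 : deriv (fun t => f β t - f α t) τ = f' β τ - f' α τ := ((hf β τ).sub (hf α τ)).deriv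
    rw [h3]
    exact (le_abs_self _).trans (hlip β τ ⟨hτ.1.le, hτ.2.le.trans ht.2⟩)
  rw [h0, h0] at h2
  nlinarith [mul_lt_mul_of_pos_right hβ ht.1]

/-- Shooting: there is a solution starting at a minimum `ε` of `u` whose odd derivatives vanish at
`0` and at a later time `s`, and which increases in between. -/
theorem exists_half_period {lam mu ε e : ℝ} {g : ℝ → ℝ} {Kg : ℝ≥0} (hlam : 0 < lam) (hmu : 0 < mu)
    (hg : LipschitzWith Kg g) (hgm : StrictMono g) (hε : ε < e)
    (hlt : ∀ x ∈ Ico ε e, g x < lam * mu * x)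
    (hgt : ∀ c > e, ∃ r > 0, ∀ x ≥ c, lam * mu * x + r ≤ g x) :
    ∃ (u u₁ w w₁ : ℝ → ℝ) (s : ℝ), IsSol lam mu g u u₁ w w₁ ∧ u 0 = ε ∧ u₁ 0 = 0 ∧ w₁ 0 = 0 ∧
      lam * u 0 + w 0 ∈ Icc 0 ((lam * mu * ε - g ε) / mu) ∧
      0 < s ∧ u₁ s = 0 ∧ w₁ s = 0 ∧ ∀ t ∈ Ioo 0 s, 0 < u₁ t := by
  obtain ⟨u, u₁, w, w₁, hsol, hdep⟩ := exists_family lam mu ε hg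
  obtain ⟨α₀, hα₀⟩ : ∃ α₀, α₀ = (lam * mu * ε - g ε) / mu := ⟨_, rfl⟩
  have hα₀pos : 0 < α₀ := by
    rw [hα₀]
    exact div_pos (by linarith [hlt ε ⟨le_rfl, hε⟩]) hmu
  have hu2 : ∀ α, lam * u α 0 + w α 0 = α := fun α => by
    obtain ⟨-, h0, -, h2, -⟩ := hsol α
    rw [h0, h2]
    ring
  have hw2 : ∀ α, mu * w α 0 + g (u α 0) = mu * (α - α₀) := fun α => by
    obtain ⟨-, h0, -, h2, -⟩ := hsol α
    rw [h0, h2, hα₀]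
    field_simp
    ring
  obtain ⟨A, hA⟩ : ∃ A : Set ℝ,
    A = {α | α < α₀ ∧ ∃ t > 0, u₁ α t < 0 ∧ ∀ τ ∈ Ioc 0 t, w₁ α τ < 0} := ⟨_, rfl⟩
  obtain ⟨B, hB⟩ : ∃ B : Set ℝ,
    B = {α | 0 < α ∧ ∃ t > 0, 0 < w₁ α t ∧ ∀ τ ∈ Ioc 0 t, 0 < u₁ α τ} := ⟨_, rfl⟩
  have hlipu : ∀ T, ∃ C ≥ 0, ∀ α β, ∀ t ∈ Icc 0 T,
      |(lam * u β t + w β t) - (lam * u α t + w α t)| ≤ C * |β - α| := fun T => by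
    obtain ⟨C, hC, h⟩ := hdep T
    refine ⟨lam * C + C, by positivity, fun α β t ht => ?_⟩
    obtain ⟨h1, h2⟩ := h β α t ht
    rw [abs_le] at h1 h2 ⊢
    have := mul_le_mul_of_nonneg_left h1.1 hlam.le
    have := mul_le_mul_of_nonneg_left h1.2 hlam.le
    constructor <;> linarith [h2.1, h2.2]
  have hlipw : ∀ T, ∃ C ≥ 0, ∀ α β, ∀ t ∈ Icc 0 T,
      |(mu * w β t + g (u β t)) - (mu * w α t + g (u α t))| ≤ C * |β - α| := fun T => by
    obtain ⟨C, hC, h⟩ := hdep T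
    refine ⟨mu * C + Kg * C, by positivity, fun α β t ht => ?_⟩
    obtain ⟨h1, h2⟩ := h β α t ht
    have h3 := hg.dist_le_mul (u β t) (u α t)
    rw [Real.dist_eq, Real.dist_eq] at h3
    have h4 := h3.trans (mul_le_mul_of_nonneg_left h1 Kg.2)
    change _ ≤ (Kg : ℝ) * _ at h4
    rw [abs_le] at h2 h4 ⊢
    have := mul_le_mul_of_nonneg_left h2.1 hmu.le
    have := mul_le_mul_of_nonneg_left h2.2 hmu.le
    constructor <;> linarith [h4.1, h4.2]
  have hslope : ∀ {f f' : ℝ → ℝ → ℝ} {t : ℝ}, 0 < t → (∀ β t, HasDerivAt (f β) (f' β t) t) →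
      (∀ β, f β 0 = 0) → (∀ T, ∃ C ≥ 0, ∀ α β, ∀ t ∈ Icc 0 T,
        |f' β t - f' α t| ≤ C * |β - α|) → Continuous fun β => f β t := by
    intro f f' t ht hf h0 hlip
    obtain ⟨C, hC, hl⟩ := hlip t
    have hb : ∀ α β, dist (f β t) (f α t) ≤ C * t * dist β α := fun α β => by
      have := Convex.norm_image_sub_le_of_norm_hasDerivWithin_le (s := Icc 0 t)
        (f := fun t => f β t - f α t) (f' := fun t => f' β t - f' α t) (C := C * |β - α|)
        (fun τ _ => ((hf β τ).sub (hf α τ)).hasDerivWithinAt) (fun τ hτ => hl α β τ hτ)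
        (convex_Icc 0 t) (left_mem_Icc.2 ht.le) (right_mem_Icc.2 ht.le)
      rw [h0, h0, sub_self, sub_zero, sub_zero, Real.norm_eq_abs, Real.norm_eq_abs,
        abs_of_pos ht] at this
      rw [Real.dist_eq, Real.dist_eq]
      linarith
    exact (LipschitzWith.of_dist_le_mul (K := ⟨C * t, by positivity⟩)
      fun β α => hb α β).continuous
  have hdu : ∀ β t, HasDerivAt (u₁ β) (lam * u β t + w β t) t := fun β t => (hsol β).1.du₁ t
  have hdw : ∀ β t, HasDerivAt (w₁ β) (mu * w β t + g (u β t)) t := fun β t => (hsol β).1.dw₁ t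
  have hu₁0 : ∀ β, u₁ β 0 = 0 := fun β => (hsol β).2.2.1
  have hw₁0 : ∀ β, w₁ β 0 = 0 := fun β => (hsol β).2.2.2.2
  have hAo : IsOpen A := by
    rw [isOpen_iff_mem_nhds, hA]
    rintro α ⟨hα, t, ht, hut, hwt⟩
    obtain ⟨C, hC, hl⟩ := hlipw t
    have h1 := eventually_forall_Ioc_neg ht hC hdw hw₁0 (fun β τ hτ => hl α β τ hτ)
      (by rw [hw2]; exact mul_neg_of_pos_of_neg hmu (by linarith)) hwt
    filter_upwards [h1, Iio_mem_nhds hα,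
      ((hslope ht hdu hu₁0 hlipu).tendsto α).eventually_lt_const hut] with β hβ1 hβ2 hβ3
    exact ⟨hβ2, t, ht, hβ3, hβ1⟩
  have hBo : IsOpen B := by
    rw [isOpen_iff_mem_nhds, hB]
    rintro α ⟨hα, t, ht, hwt, hut⟩
    obtain ⟨C, hC, hl⟩ := hlipu t
    have h1 := eventually_forall_Ioc_neg (f := fun β t => -u₁ β t) ht hC
      (fun β τ => (hdu β τ).neg) (fun β => by simp [hu₁0])
      (fun β τ hτ => by rw [neg_sub_neg, abs_sub_comm]; exact hl α β τ hτ)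
      (by rw [hu2]; linarith) (fun τ hτ => neg_neg_of_pos (hut τ hτ))
    filter_upwards [h1, Ioi_mem_nhds hα,
      ((hslope ht hdw hw₁0 hlipw).tendsto α).eventually_const_lt hwt] with β hβ1 hβ2 hβ3
    exact ⟨hβ2, t, ht, hβ3, fun τ hτ => neg_neg_iff_pos.1 (hβ1 τ hτ)⟩
  have h0A : (0 : ℝ) ∈ A := by
    rw [hA]
    exact ⟨hα₀pos, (hsol 0).1.exists_u₁_neg hlam.le (hu₁0 0) (hw₁0 0) (hu2 0)
      (by rw [hw2]; exact mul_neg_of_pos_of_neg hmu (by linarith))⟩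
  have hα₀B : α₀ ∈ B := by
    rw [hB]
    exact ⟨hα₀pos, (hsol α₀).1.exists_w₁_pos hmu.le hgm (hu₁0 α₀) (hw₁0 α₀)
      (by rw [hu2]; exact hα₀pos) (by rw [hw2]; simp)⟩
  have hdisj : ∀ α, α ∈ A → α ∉ B := by
    intro α hαA hαB
    rw [hA] at hαA
    rw [hB] at hαB
    obtain ⟨-, t, ht, hut, hwt⟩ := hαA
    obtain ⟨-, t', ht', hwt', hut'⟩ := hαB
    rcases le_total t t' with h | h
    · linarith [hut' t ⟨ht, h⟩]
    · linarith [hwt t' ⟨ht', h⟩]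
  obtain ⟨α, hαI, hαA, hαB⟩ : ∃ α ∈ Icc 0 α₀, α ∉ A ∧ α ∉ B := by
    by_contra! hcon
    obtain ⟨α, -, hαA, hαB⟩ := isPreconnected_Icc A B hAo hBo
      (fun α hα => or_iff_not_imp_left.2 (hcon α hα))
      ⟨0, left_mem_Icc.2 hα₀pos.le, h0A⟩ ⟨α₀, right_mem_Icc.2 hα₀pos.le, hα₀B⟩
    exact hdisj α hαA hαB
  have hαpos : 0 < α := lt_of_le_of_ne hαI.1 fun h => hαA (h ▸ h0A)
  have hαlt : α < α₀ := lt_of_le_of_ne hαI.2 fun h => hαB (h ▸ hα₀B)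
  rw [hA] at hαA
  rw [hB] at hαB
  obtain ⟨hs, hu0, -⟩ := hsol α
  obtain ⟨s, hs0, h1, h2, h3⟩ := hs.exists_common_zero hlam.le hmu hgm
    (by rw [hu0]; exact hlt) hgt (hu₁0 α) (hw₁0 α)
    (by rw [hu2]; exact hαpos) (by rw [hw2]; exact mul_neg_of_pos_of_neg hmu (by linarith))
    (fun h => hαA ⟨hαlt, h⟩) (fun h => hαB ⟨hαpos, h⟩)
  exact ⟨u α, u₁ α, w α, w₁ α, s, hs, hu0, hu₁0 α, hw₁0 α, by rw [hu2, ← hα₀]; exact hαI,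
    hs0, h1, h2, h3⟩

section Power

theorem exists_lipschitzOnWith_rpow {a b : ℝ} (p : ℝ) (ha : 0 < a) :
    ∃ K : ℝ≥0, LipschitzOnWith K (fun x : ℝ => x ^ p) (Icc a b) := by
  have h : LocallyLipschitzOn (Icc a b) fun x : ℝ => x ^ p := fun x hx => by
    have hx0 : x ≠ 0 := (ha.trans_le hx.1).ne'
    obtain ⟨K, t, ht, hK⟩ :=
      (Real.contDiffAt_rpow_const_of_ne (p := p) (n := 1) hx0).exists_lipschitzOnWith
    exact ⟨K, t, mem_nhdsWithin_of_mem_nhds ht, hK⟩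
  exact h.exists_lipschitzOnWith_of_compact isCompact_Icc

/-- The power `C * x ^ (q + 1)`, continued outside `[a, b]` by linear functions so as to be of the
form `x * (C * k ^ q)` with `k` the projection of `x` to `[a, b]`. -/
noncomputable def truncPow (C q a b x : ℝ) : ℝ :=
  C * (max a (min x b) ^ (q + 1) + a ^ q * min (x - a) 0 + b ^ q * max (x - b) 0)

variable {C q a b : ℝ}

theorem truncPow_of_mem {x : ℝ} (hx : x ∈ Icc a b) :
    truncPow C q a b x = C * x ^ (q + 1) := by
  simp [truncPow, hx.1, hx.2]

theorem truncPow_eq_mul (ha : 0 < a) (hab : a ≤ b) (x : ℝ) :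
    truncPow C q a b x = x * (C * max a (min x b) ^ q) := by
  have hb : 0 < b := ha.trans_le hab
  rw [truncPow, Real.rpow_add_one (ha.trans_le (le_max_left _ _)).ne']
  rcases le_total x a with h | h
  · rw [min_eq_left (h.trans hab), max_eq_left h, min_eq_left (by linarith),
      max_eq_right (by linarith)]
    ring
  rcases le_total x b with h' | h'
  · rw [min_eq_left h', max_eq_right h, min_eq_right (by linarith), max_eq_right (by linarith)]
    ring
  · rw [min_eq_right h', max_eq_right hab, min_eq_right (by linarith), max_eq_left (by linarith)]
    ring

theorem strictMono_truncPow (hC : 0 < C) (hq : 0 < q) (ha : 0 < a) (hab : a ≤ b) :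
    StrictMono (truncPow C q a b) := by
  intro x y hxy
  have hb : 0 < b := ha.trans_le hab
  have hsum : ∀ x, max a (min x b) + min (x - a) 0 + max (x - b) 0 = x := fun x => by
    rcases le_total x a with h | h
    · rw [min_eq_left (h.trans hab), max_eq_left h, min_eq_left (by linarith),
        max_eq_right (by linarith)]
      ring
    rcases le_total x b with h' | h'
    · rw [min_eq_left h', max_eq_right h, min_eq_right (by linarith), max_eq_right (by linarith)]
      ring
    · rw [min_eq_right h', max_eq_right hab, min_eq_right (by linarith), max_eq_left (by linarith)]
      ring
  have h1 : max a (min x b) ≤ max a (min y b) := by gcongr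
  have h2 : min (x - a) 0 ≤ min (y - a) 0 := by gcongr
  have h3 : max (x - b) 0 ≤ max (y - b) 0 := by gcongr
  have ha' : 0 < a ^ q := Real.rpow_pos_of_pos ha q
  have hb' : 0 < b ^ q := Real.rpow_pos_of_pos hb q
  have hk : 0 ≤ max a (min x b) := ha.le.trans (le_max_left _ _)
  have g1 : max a (min x b) ^ (q + 1) ≤ max a (min y b) ^ (q + 1) := by gcongr
  have g2 := mul_le_mul_of_nonneg_left h2 ha'.le
  have g3 := mul_le_mul_of_nonneg_left h3 hb'.le
  refine mul_lt_mul_of_pos_left ?_ hC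
  rcases h1.lt_or_eq with h | e1
  · have := Real.rpow_lt_rpow hk h (by linarith : 0 < q + 1)
    linarith
  rcases h2.lt_or_eq with h | e2
  · have := mul_lt_mul_of_pos_left h ha'
    linarith
  rcases h3.lt_or_eq with h | e3
  · have := mul_lt_mul_of_pos_left h hb'
    linarith
  · have := hsum x
    rw [e1, e2, e3, hsum y] at this
    linarith

theorem exists_lipschitzWith_truncPow (ha : 0 < a) (hab : a ≤ b) :
    ∃ K : ℝ≥0, LipschitzWith K (truncPow C q a b) := by
  obtain ⟨K, hK⟩ := exists_lipschitzOnWith_rpow (b := b) (q + 1) ha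
  have h1 : LipschitzWith 1 fun x : ℝ => max a (min x b) :=
    (LipschitzWith.id.min_const b).const_max a
  have h2 : LipschitzWith (K * 1) fun x : ℝ => max a (min x b) ^ (q + 1) :=
    lipschitzOnWith_univ.1 (hK.comp (lipschitzOnWith_univ.2 h1) fun x _ =>
      ⟨le_max_left _ _, max_le hab (min_le_right _ _)⟩)
  have h3 : ∀ c : ℝ, LipschitzWith 1 fun x : ℝ => x - c := fun c =>
    LipschitzWith.of_dist_le_mul fun x y => by simp
  have hs : ∀ (c : ℝ) {f : ℝ → ℝ} {Kf : ℝ≥0}, LipschitzWith Kf f →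
      LipschitzWith (‖c‖₊ * Kf) fun x => c * f x := fun c f Kf hf =>
    (lipschitzWith_smul c).comp hf
  exact ⟨_, hs C ((h2.add (hs (a ^ q) ((h3 a).min_const 0))).add
    (hs (b ^ q) ((h3 b).max_const 0)))⟩

theorem exists_periodic_solution {lam mu ε e : ℝ} (hlam : 0 < lam) (hmu : 0 < mu) (hC : 0 < C)
    (hq : 0 < q) (hε : 0 < ε) (hεe : ε < e) (he : C * e ^ q = lam * mu) :
    ∃ (u u₁ w w₁ : ℝ → ℝ) (T : ℝ), IsSol lam mu (fun x => C * x ^ (q + 1)) u u₁ w w₁ ∧ 0 < T ∧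
      Function.Periodic u T ∧ u 0 = ε ∧ ∀ t, ε ≤ u t := by
  have he0 : 0 < e := hε.trans hεe
  obtain ⟨B, hB⟩ : ∃ B, B = lam * mu := ⟨_, rfl⟩
  have hB0 : 0 < B := hB ▸ mul_pos hlam hmu
  obtain ⟨m, hm1, hme, hmB⟩ : ∃ m : ℝ, 1 ≤ m ∧ e < m ∧ B + 1 ≤ C * m ^ q :=
    ((eventually_ge_atTop 1).and ((eventually_gt_atTop e).and
      (((tendsto_rpow_atTop hq).const_mul_atTop hC).eventually_ge_atTop (B + 1)))).exists
  obtain ⟨α₀, hα₀⟩ : ∃ α₀, α₀ = (lam * mu * ε - C * ε ^ (q + 1)) / mu := ⟨_, rfl⟩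
  obtain ⟨M, hM⟩ : ∃ M, M = m + B * m * (m - ε) + α₀ ^ 2 / 2 := ⟨_, rfl⟩
  have hmM : m ≤ M := by
    have : 0 ≤ B * m * (m - ε) := mul_nonneg (by positivity) (by linarith)
    have : 0 ≤ α₀ ^ 2 / 2 := by positivity
    linarith
  have hεM : ε ≤ M := by linarith
  have hmul := truncPow_eq_mul (C := C) (q := q) hε hεM
  have hmono := strictMono_truncPow hC hq hε hεM
  obtain ⟨Kg, hg⟩ := exists_lipschitzWith_truncPow (C := C) (q := q) hε hεM
  obtain ⟨g, hgdef⟩ : ∃ g, g = truncPow C q ε M := ⟨_, rfl⟩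
  rw [← hgdef] at hmul hmono hg
  have hlt : ∀ x ∈ Ico ε e, g x < lam * mu * x := fun x hx => by
    have hx0 : 0 < x := hε.trans_le hx.1
    rw [hmul, mul_comm, ← he, min_eq_left (by linarith [hx.2]), max_eq_right hx.1]
    have := hx.2
    gcongr
  have hgt : ∀ c > e, ∃ r > 0, ∀ x ≥ c, lam * mu * x + r ≤ g x := fun c hc => by
    have hk : e < max ε (min c M) := lt_max_of_lt_right (lt_min hc (by linarith))
    have hk' : lam * mu < C * max ε (min c M) ^ q := by
      rw [← he]
      gcongr
    refine ⟨c * (C * max ε (min c M) ^ q - lam * mu),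
      mul_pos (he0.trans hc) (sub_pos.2 hk'), fun x hx => ?_⟩
    have h1 : max ε (min c M) ≤ max ε (min x M) := by gcongr
    have h2 : C * max ε (min c M) ^ q ≤ C * max ε (min x M) ^ q := by
      have := he0.le.trans hk.le
      gcongr
    rw [hmul]
    nlinarith [mul_nonneg (sub_nonneg.2 hx) (sub_nonneg.2 hk'.le),
      mul_nonneg ((he0.trans hc).le.trans hx) (sub_nonneg.2 h2)]
  obtain ⟨u, u₁, w, w₁, s, hsol, hu0, hu₁0, hw₁0, hα, hs, hus, hws, hpos⟩ :=
    exists_half_period hlam hmu hg hmono hεe hlt hgt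
  have hgε : g ε = C * ε ^ (q + 1) := hgdef ▸ truncPow_of_mem ⟨le_rfl, hεM⟩
  rw [hgε, ← hα₀] at hα
  have hFd : ∀ x, HasDerivAt (fun x => lam * mu * x ^ 2 / 2 - ∫ y in (0 : ℝ)..x, g y)
      (lam * mu * x - g x) x := fun x => by
    refine ((((hasDerivAt_id x).pow 2).const_mul (lam * mu)).div_const 2).sub
      (hg.continuous.integral_hasStrictDerivAt 0 x).hasDerivAt |>.congr_deriv ?_
    simp
    ring
  obtain ⟨F, hF⟩ : ∃ F : ℝ → ℝ, ∀ x, HasDerivAt F (lam * mu * x - g x) x := ⟨_, hFd⟩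
  have hFdiff : Differentiable ℝ F := fun x => (hF x).differentiableAt
  have hen := hsol.energy hF hu₁0 hus
  have hle : u s ≤ M := by
    by_contra! hMs
    have h1 : F m - F ε ≤ B * m * (m - ε) := by
      refine (convex_Icc ε m).image_sub_le_mul_sub_of_deriv_le hFdiff.continuous.continuousOn
        hFdiff.differentiableOn (fun x hx => ?_) ε (left_mem_Icc.2 (by linarith)) m
        (right_mem_Icc.2 (by linarith)) (by linarith)
      rw [interior_Icc] at hx
      have hx0 : 0 < x := hε.trans hx.1
      have : 0 ≤ g x := by
        rw [hmul]
        positivity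
      rw [(hF x).deriv, ← hB]
      nlinarith [hx.2]
    have h2 : F (u s) - F m ≤ -1 * (u s - m) := by
      refine (convex_Icc m (u s)).image_sub_le_mul_sub_of_deriv_le hFdiff.continuous.continuousOn
        hFdiff.differentiableOn (fun x hx => ?_) m (left_mem_Icc.2 (by linarith)) (u s)
        (right_mem_Icc.2 (by linarith)) (by linarith)
      rw [interior_Icc] at hx
      have h3 : m ≤ max ε (min x M) := le_max_of_le_right (le_min hx.1.le hmM)
      have h4 : C * m ^ q ≤ C * max ε (min x M) ^ q := by gcongr
      rw [(hF x).deriv, ← hB, hmul]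
      nlinarith [mul_nonneg (by linarith [hx.1] : 0 ≤ x) (sub_nonneg.2 (hmB.trans h4)), hx.1]
    have h3 : (lam * u 0 + w 0) ^ 2 ≤ α₀ ^ 2 := by
      have := hα.1
      have := hα.2
      gcongr
    rw [hu0] at hen h3
    linarith
  have hmem : ∀ t, u t ∈ Icc ε M := fun t => by
    have := hsol.mem_Icc hg hs hu₁0 hw₁0 hus hws hpos t
    exact ⟨hu0 ▸ this.1, this.2.trans hle⟩
  refine ⟨u, u₁, w, w₁, 2 * s, ⟨hsol.du, hsol.du₁, hsol.dw, fun t => ?_⟩, by positivity,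
    hsol.periodic hg hu₁0 hw₁0 hus hws, hu0, fun t => (hmem t).1⟩
  have := hsol.dw₁ t
  rwa [hgdef, truncPow_of_mem (hmem t)] at this

end Power

section Ode

variable {lam mu : ℝ}

theorem IsSol.of_contDiff {g v : ℝ → ℝ} (hv : ContDiff ℝ 4 v)
    (hode : ∀ t, iteratedDeriv 4 v t - (lam + mu) * iteratedDeriv 2 v t + lam * mu * v t
      = g (v t)) :
    IsSol lam mu g v (iteratedDeriv 1 v) (fun t => iteratedDeriv 2 v t - lam * v t)
      (fun t => iteratedDeriv 3 v t - lam * iteratedDeriv 1 v t) := by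
  have h : ∀ k : ℕ, k < 4 → ∀ t, HasDerivAt (iteratedDeriv k v) (iteratedDeriv (k + 1) v t) t :=
    fun k hk t => by
      rw [iteratedDeriv_succ]
      exact (hv.differentiable_iteratedDeriv k (by exact_mod_cast hk) t).hasDerivAt
  have h0 : ∀ t, HasDerivAt v (iteratedDeriv 1 v t) t := fun t => by
    simpa using h 0 (by norm_num) t
  refine ⟨h0, fun t => ?_, fun t => ?_, fun t => ?_⟩
  · exact (h 1 (by norm_num) t).congr_deriv (by ring)
  · exact (h 2 (by norm_num) t).sub ((h0 t).const_mul lam)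
  · refine ((h 3 (by norm_num) t).sub ((h 1 (by norm_num) t).const_mul lam)).congr_deriv ?_
    simp only [Nat.reduceAdd]
    linear_combination hode t

theorem IsSol.iteratedDeriv_eq {g u u₁ w w₁ : ℝ → ℝ} (h : IsSol lam mu g u u₁ w w₁) :
    iteratedDeriv 1 u = u₁ ∧ iteratedDeriv 2 u = (fun t => lam * u t + w t) ∧
      iteratedDeriv 3 u = (fun t => lam * u₁ t + w₁ t) ∧
      iteratedDeriv 4 u = fun t => lam * (lam * u t + w t) + (mu * w t + g (u t)) := by
  have h1 : iteratedDeriv 1 u = u₁ := by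
    rw [iteratedDeriv_one]
    exact funext fun t => (h.du t).deriv
  have h2 : iteratedDeriv 2 u = fun t => lam * u t + w t := by
    rw [iteratedDeriv_succ, h1]
    exact funext fun t => (h.du₁ t).deriv
  have h3 : iteratedDeriv 3 u = fun t => lam * u₁ t + w₁ t := by
    rw [iteratedDeriv_succ, h2]
    exact funext fun t => (((h.du t).const_mul lam).add (h.dw t)).deriv
  refine ⟨h1, h2, h3, ?_⟩
  rw [iteratedDeriv_succ, h3]
  exact funext fun t => (((h.du₁ t).const_mul lam).add (h.dw₁ t)).deriv

theorem IsSol.contDiff {g u u₁ w w₁ : ℝ → ℝ} (h : IsSol lam mu g u u₁ w w₁)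
    (hg : Continuous fun t => g (u t)) : ContDiff ℝ 4 u := by
  obtain ⟨h1, h2, h3, h4⟩ := h.iteratedDeriv_eq
  have hu : Differentiable ℝ u := fun t => (h.du t).differentiableAt
  have hu₁ : Differentiable ℝ u₁ := fun t => (h.du₁ t).differentiableAt
  have hw : Differentiable ℝ w := fun t => (h.dw t).differentiableAt
  have hw₁ : Differentiable ℝ w₁ := fun t => (h.dw₁ t).differentiableAt
  refine contDiff_nat_iff_iteratedDeriv (n := 4) |>.2 ⟨fun m hm => ?_, fun m hm => ?_⟩
  · interval_cases m
    · simpa using hu.continuous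
    · exact h1 ▸ hu₁.continuous
    · exact h2 ▸ ((hu.const_mul lam).add hw).continuous
    · exact h3 ▸ ((hu₁.const_mul lam).add hw₁).continuous
    · have := hu.continuous
      have := hw.continuous
      rw [h4]
      exact (continuous_const.mul ((continuous_const.mul ‹Continuous u›).add ‹Continuous w›)).add
        ((continuous_const.mul ‹Continuous w›).add hg)
  · interval_cases m
    · simpa using hu
    · exact h1 ▸ hu₁
    · exact h2 ▸ (hu.const_mul lam).add hw
    · exact h3 ▸ (hu₁.const_mul lam).add hw₁

theorem eq_of_isSol_rpow {C p a : ℝ} (hlam : 0 ≤ lam) (hmu : 0 ≤ mu) (hC : 0 ≤ C) (hp : 0 ≤ p)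
    (ha : 0 < a) {u u₁ w w₁ v v₁ z z₁ : ℝ → ℝ} {S T : ℝ}
    (hu : IsSol lam mu (fun x => C * x ^ p) u u₁ w w₁)
    (hv : IsSol lam mu (fun x => C * x ^ p) v v₁ z z₁) (hS : 0 < S) (hT : 0 < T)
    (huS : Function.Periodic u S) (hvT : Function.Periodic v T) (hau : ∀ t, a ≤ u t)
    (hav : ∀ t, a ≤ v t) (hu0 : u 0 = a) (hv0 : v 0 = a) : u = v := by
  have hbdd : ∀ {f f₁ : ℝ → ℝ} {T : ℝ}, (∀ t, HasDerivAt f (f₁ t) t) → 0 < T →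
      Function.Periodic f T → ∃ b, ∀ t, f t ≤ b := fun {f f₁ T} hf hT hper => by
    have hc : Continuous f := Differentiable.continuous fun t => (hf t).differentiableAt
    obtain ⟨b, hb⟩ := (isCompact_Icc (a := (0 : ℝ)) (b := 0 + T)).bddAbove_image hc.continuousOn
    refine ⟨b, fun t => hb ?_⟩
    rw [hper.image_Icc hT]
    exact mem_range_self t
  obtain ⟨b, hb⟩ := hbdd hu.du hS huS
  obtain ⟨c, hc⟩ := hbdd hv.du hT hvT
  have hcrit : ∀ {f f₁ : ℝ → ℝ}, (∀ t, HasDerivAt f (f₁ t) t) → (∀ t, a ≤ f t) → f 0 = a →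
      f₁ 0 = 0 := fun {f f₁} hf hle h0 => by
    refine IsLocalMin.hasDerivAt_eq_zero (Eventually.of_forall fun t => ?_) (hf 0)
    rw [h0]
    exact hle t
  obtain ⟨K, hK⟩ := exists_lipschitzOnWith_rpow (b := max b c) p ha
  have hum : ∀ t, u t ∈ Icc a (max b c) := fun t => ⟨hau t, (hb t).trans (le_max_left _ _)⟩
  have hvm : ∀ t, v t ∈ Icc a (max b c) := fun t => ⟨hav t, (hc t).trans (le_max_right _ _)⟩
  have key : ∀ x ∈ Icc a (max b c), ∀ y ∈ Icc a (max b c), y ≤ x →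
      0 ≤ C * x ^ p - C * y ^ p ∧ C * x ^ p - C * y ^ p ≤ C * K * (x - y) :=
    fun x hx y hy hyx => by
      have h1 : y ^ p ≤ x ^ p := Real.rpow_le_rpow (ha.le.trans hy.1) hyx hp
      have h2 := hK.dist_le_mul x hx y hy
      rw [Real.dist_eq, Real.dist_eq, abs_of_nonneg (sub_nonneg.2 h1),
        abs_of_nonneg (sub_nonneg.2 hyx)] at h2
      have h3 := mul_le_mul_of_nonneg_left h2 hC
      have h4 := mul_le_mul_of_nonneg_left h1 hC
      exact ⟨by linarith, by linarith⟩
  have hL : 0 ≤ C * K := by positivity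
  refine funext fun t => sub_eq_zero.1 (eq_zero_of_bounded
    (D := fun t => u t - v t) (D₁ := fun t => u₁ t - v₁ t) (W := fun t => w t - z t)
    (W₁ := fun t => w₁ t - z₁ t) (N := fun t => C * u t ^ p - C * v t ^ p)
    (L := C * K) (M := max b c - a) hlam hmu hL
    (fun t => (hu.du t).sub (hv.du t))
    (fun t => ((hu.du₁ t).sub (hv.du₁ t)).congr_deriv (by ring))
    (fun t => (hu.dw t).sub (hv.dw t))
    (fun t => ((hu.dw₁ t).sub (hv.dw₁ t)).congr_deriv (by ring))
    (fun t => ?_) (fun t => ?_) (fun t => ?_) ?_ ?_ t)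
  · rcases le_total (v t) (u t) with h | h
    · rw [min_eq_right (sub_nonneg.2 h), mul_zero]
      exact (key _ (hum t) _ (hvm t) h).1
    · rw [min_eq_left (sub_nonpos.2 h)]
      linarith [(key _ (hvm t) _ (hum t) h).2]
  · rcases le_total (v t) (u t) with h | h
    · rw [max_eq_left (sub_nonneg.2 h)]
      exact (key _ (hum t) _ (hvm t) h).2
    · rw [max_eq_right (sub_nonpos.2 h), mul_zero]
      linarith [(key _ (hvm t) _ (hum t) h).1]
  · have h1 := hum t
    have h2 := hvm t
    exact abs_le.2 ⟨by linarith [h1.1, h2.2], by linarith [h1.2, h2.1]⟩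
  · simp [hu0, hv0]
  · simp [hcrit hu.du hau hu0, hcrit hv.du hav hv0]

end Ode

end Delaunay

/-- for each `ε ∈ (0, ε_n)` there is a unique C⁴ positive periodic solution
of the Delaunay ODE attaining its minimum value `ε` at `t = 0`. -/
theorem delaunay_existence_uniqueness (n : ℕ) (hn : 5 ≤ n) (ε : ℝ)
    (hε0 : 0 < ε) (hεn : ε < epsN n) :
    ∃! v : ℝ → ℝ, ContDiff ℝ 4 v ∧ (∀ t, 0 < v t) ∧ (∀ t, DelaunayODE n v t)
      ∧ (∃ T > 0, Function.Periodic v T) ∧ v 0 = ε ∧ (∀ t, ε ≤ v t) := by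
  have hn5 : (5 : ℝ) ≤ n := by exact_mod_cast hn
  obtain ⟨x, hx⟩ : ∃ x : ℝ, x = n := ⟨_, rfl⟩
  rw [← hx] at hn5
  have hx4 : 0 < x - 4 := by linarith
  have hx2 : 0 < x ^ 2 - 4 := by nlinarith
  have hx0 : 0 < x := by linarith
  have hlam : 0 < x ^ 2 / 4 := by positivity
  have hmu : 0 < (x - 4) ^ 2 / 4 := by positivity
  have hC : 0 < x * (x - 4) * (x ^ 2 - 4) / 16 := by positivity
  have hq : 0 < 8 / (x - 4) := by positivity
  have hp : (x + 4) / (x - 4) = 8 / (x - 4) + 1 := by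
    field_simp
    ring
  have he : x * (x - 4) * (x ^ 2 - 4) / 16 * epsN n ^ (8 / (x - 4))
      = x ^ 2 / 4 * ((x - 4) ^ 2 / 4) := by
    rw [epsN, ← hx, ← Real.rpow_mul (by positivity),
      show (x - 4) / 8 * (8 / (x - 4)) = 1 by field_simp, Real.rpow_one]
    field_simp
    norm_num
  have hode : ∀ v : ℝ → ℝ, ∀ t, DelaunayODE n v t ↔
      iteratedDeriv 4 v t - (x ^ 2 / 4 + (x - 4) ^ 2 / 4) * iteratedDeriv 2 v t
        + x ^ 2 / 4 * ((x - 4) ^ 2 / 4) * v t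
      = (fun y => x * (x - 4) * (x ^ 2 - 4) / 16 * y ^ (8 / (x - 4) + 1)) (v t) := fun v t => by
    rw [DelaunayODE, ← hx, hp]
    ring_nf
  obtain ⟨u, u₁, w, w₁, T, hsol, hT, hper, hu0, hle⟩ :=
    Delaunay.exists_periodic_solution hlam hmu hC hq hε0 hεn he
  have hcu : Continuous u := Differentiable.continuous fun t => (hsol.du t).differentiableAt
  refine ⟨u, ⟨hsol.contDiff ?_, fun t => hε0.trans_le (hle t), fun t => ?_, ⟨T, hT, hper⟩, hu0,
    hle⟩, ?_⟩
  · exact continuous_const.mul (hcu.rpow_const fun t => Or.inl (hε0.trans_le (hle t)).ne')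
  · obtain ⟨-, h2, -, h4⟩ := hsol.iteratedDeriv_eq
    rw [hode, h2, h4]
    ring
  · rintro v ⟨hv, -, hvode, ⟨S, hS, hvS⟩, hv0, hvle⟩
    exact Delaunay.eq_of_isSol_rpow hlam.le hmu.le hC.le (by positivity) hε0
      (Delaunay.IsSol.of_contDiff hv fun t => (hode v t).1 (hvode t)) hsol hS hT hvS hper hvle hle
      hv0 hu0
end
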